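/- Let B_n denote the number of quarter-plane walks of length n with steps from ℬ = {(−1,1),(0,1),(1,0),(1,−1)}, and let B(t) = Σ_{n≥0} B_n t^n be the associated formal power series over ℚ. Then B(t) is not D-finite: there do not exist a natural number r and polynomials p_0,…,p_r ∈ ℚ[t], not all zero, such that Σ_{i=0}^r p_i(t)·B^{(i)}(t) = 0 as formal power series. -/

import Mathlib

/-- The number of quarter-plane walks of length `n` with steps from `S`:
sequences of `n` steps, each in `S`, all of whose partial sums have both
coordinates nonnegative. -/
noncomputable def quarterPlaneWalks (S : Finset (ℤ × ℤ)) (n : ℕ) : ℕ :=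
  Nat.card {f : Fin n → ℤ × ℤ //
    (∀ k, f k ∈ S) ∧
    ∀ k : Fin n, 0 ≤ ∑ j ∈ Finset.Iic k, (f j).1 ∧ 0 ≤ ∑ j ∈ Finset.Iic k, (f j).2}

/-- The counting generating function of quarter-plane walks with steps
from `S`, as a formal power series over ℚ. -/
noncomputable def walkGF (S : Finset (ℤ × ℤ)) : PowerSeries ℚ :=
  PowerSeries.mk fun n => (quarterPlaneWalks S n : ℚ)

/-- The reciprocal kernel iterates, as a sequence depending on `a = 1/t` and `w`. -/
def zSeq (a w : ℂ) : ℕ → ℂ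
  | 0 => 1
  | 1 => w
  | (n + 2) => a * zSeq a w (n + 1) - 1 - zSeq a w n

/-- The same recurrence started at `0, 0`. -/
def sSeq (a : ℂ) : ℕ → ℂ
  | 0 => 0
  | 1 => 0
  | (n + 2) => a * sSeq a (n + 1) - 1 - sSeq a n

lemma zSeq_kernel {a w : ℂ} (h : w ^ 2 + w + 2 = a * w) (n : ℕ) :
    zSeq a w n ^ 2 + zSeq a w (n + 1) ^ 2 + zSeq a w n + zSeq a w (n + 1)
      = a * zSeq a w n * zSeq a w (n + 1) := by
  induction n with
  | zero => simp only [zSeq]; linear_combination h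
  | succ n ih => simp only [zSeq]; linear_combination ih

lemma sSeq_kernel (a : ℂ) (n : ℕ) :
    sSeq a n ^ 2 + sSeq a (n + 1) ^ 2 + sSeq a n + sSeq a (n + 1)
      = a * sSeq a n * sSeq a (n + 1) := by
  induction n with
  | zero => simp [sSeq]
  | succ n ih => simp only [sSeq]; linear_combination ih

lemma sSeq_closed {a q : ℂ} (h : a * q = q ^ 2 + 1) (k : ℕ) :
    sSeq a k * ((1 - q) ^ 2 * (1 + q) * q ^ k) = q * ((q ^ k - q) * (1 - q ^ k)) := by
  induction k using Nat.twoStepInduction with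
  | zero => simp [sSeq]
  | one => simp [sSeq]
  | more n ih1 ih2 =>
    simp only [sSeq]
    have e : q ^ (n + 2) = q * q ^ (n + 1) := by ring
    have e1 : q ^ (n + 1) = q * q ^ n := by ring
    rw [e]
    have : (a * sSeq a (n + 1) - 1 - sSeq a n) * ((1 - q) ^ 2 * (1 + q) * (q * q ^ (n + 1)))
      = (a * q) * (sSeq a (n + 1) * ((1 - q) ^ 2 * (1 + q) * q ^ (n + 1)))
        - ((1 - q) ^ 2 * (1 + q) * (q * q ^ (n + 1)))
        - q ^ 2 * (sSeq a n * ((1 - q) ^ 2 * (1 + q) * q ^ n)) := by rw [e1]; ring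
    rw [this, ih1, ih2, h, e1]; ring

lemma pow_ne_one_of_lt {q : ℂ} (h1 : ‖q‖ < 1) {k : ℕ} (hk : 1 ≤ k) : q ^ k ≠ 1 := by
  intro h
  have : ‖q‖ ^ k < 1 := pow_lt_one₀ (norm_nonneg _) h1 (by omega)
  rw [← norm_pow, h] at this
  simp at this

lemma sSeq_ne_zero {a q : ℂ} (h : a * q = q ^ 2 + 1) (h1 : ‖q‖ < 1) {k : ℕ} (hk : 2 ≤ k) :
    sSeq a k ≠ 0 := by
  intro h0
  have hq : q ≠ 0 := by rintro rfl; simp at h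
  have := sSeq_closed h k
  rw [h0, zero_mul] at this
  obtain ⟨j, rfl⟩ : ∃ j, k = j + 1 := ⟨k - 1, by omega⟩
  have h2 := pow_ne_one_of_lt h1 (k := j + 1) (by omega)
  have h3 := pow_ne_one_of_lt h1 (k := j) (by omega)
  have : q * ((q * (q ^ j - 1)) * (1 - q ^ (j + 1))) = 0 := by rw [this]; ring
  simp only [mul_eq_zero, sub_eq_zero] at this
  rcases this with h | (h | h) | h
  · exact hq h
  · exact hq h
  · exact h3 h
  · exact h2 h.symm

lemma zSeq_eq_sSeq {a w : ℂ} {n : ℕ} (h1 : sSeq a (n + 1) = 1) (hw : sSeq a n = w) (k j : ℕ)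
    (hk : k + j = n + 1) : zSeq a w k = sSeq a j := by
  induction k using Nat.twoStepInduction generalizing j with
  | zero => obtain rfl : j = n + 1 := by omega
            simp [zSeq, h1]
  | one => obtain rfl : j = n := by omega
           simp [zSeq, hw]
  | more k ih1 ih2 =>
    simp only [zSeq]
    rw [ih1 (j + 2) (by omega), ih2 (j + 1) (by omega)]
    simp only [sSeq]; ring

lemma zSeq_add {a w : ℂ} {n : ℕ} (h0 : zSeq a w n = 0) (h1 : zSeq a w (n + 1) = 0) (j : ℕ) :
    zSeq a w (n + j) = sSeq a j := by
  induction j using Nat.twoStepInduction with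
  | zero => simp [h0, sSeq]
  | one => simp [h1, sSeq]
  | more k ih1 ih2 =>
    rw [← add_assoc]
    simp only [zSeq, sSeq]
    rw [add_assoc, ih1, ih2]

/-- Main structure at a pole. -/
lemma pole_structure {a w q : ℂ} {n : ℕ} (h1 : sSeq a (n + 1) = 1) (hw : sSeq a n = w)
    (h : a * q = q ^ 2 + 1) (hq : ‖q‖ < 1) :
    w ^ 2 + w + 2 = a * w ∧ zSeq a w n = 0 ∧ zSeq a w (n + 1) = 0 ∧
      ∀ k, k ≠ n → k ≠ n + 1 → zSeq a w k ≠ 0 := by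
  have z0 : zSeq a w n = 0 := zSeq_eq_sSeq h1 hw n 1 rfl
  have z1 : zSeq a w (n + 1) = 0 := zSeq_eq_sSeq h1 hw (n + 1) 0 rfl
  refine ⟨?_, z0, z1, ?_⟩
  · have := sSeq_kernel a n
    rw [h1, hw] at this
    linear_combination this
  · intro k k1 k2
    rcases lt_or_ge k n with hk | hk
    · rw [zSeq_eq_sSeq h1 hw k (n + 1 - k) (by omega)]
      exact sSeq_ne_zero h hq (by omega)
    · obtain ⟨j, rfl⟩ := Nat.exists_eq_add_of_le hk
      rw [zSeq_add z0 z1]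
      exact sSeq_ne_zero h hq (by omega)

/-- Linear part of `zSeq`. -/
lemma zSeq_closed {a w q : ℂ} (ha : a - 2 ≠ 0) (h : a * q = q ^ 2 + 1) (k : ℕ) :
    (1 - q ^ 2) * (zSeq a w k - 1 / (a - 2)) * q ^ k =
      q * ((w - 1 / (a - 2)) - q * (1 - 1 / (a - 2)))
        - (q * (w - 1 / (a - 2)) - (1 - 1 / (a - 2))) * q ^ (2 * k) := by
  set C := 1 / (a - 2) with hC
  have hC' : a * C = 1 + 2 * C := by rw [hC]; field_simp; ring
  induction k using Nat.twoStepInduction with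
  | zero => simp only [zSeq]; ring
  | one => simp only [zSeq]; ring
  | more n ih1 ih2 =>
    simp only [zSeq]
    have e : (1 - q ^ 2) * (a * zSeq a w (n + 1) - 1 - zSeq a w n - C) * q ^ (n + 2)
      = (a * q) * ((1 - q ^ 2) * (zSeq a w (n + 1) - C) * q ^ (n + 1))
        - q ^ 2 * ((1 - q ^ 2) * (zSeq a w n - C) * q ^ n) := by
      have : a * zSeq a w (n + 1) - 1 - zSeq a w n - C
        = a * (zSeq a w (n + 1) - C) - (zSeq a w n - C) := by linear_combination hC'
      rw [this]; ring
    rw [e, ih1, ih2, h]; ring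

/-- The growing coefficient does not vanish. -/
lemma grow_coeff_ne {a w q : ℂ} (ha : a - 2 ≠ 0) (h : a * q = q ^ 2 + 1)
    (hk : w ^ 2 + w + 2 = a * w) :
    q * ((w - 1 / (a - 2)) - q * (1 - 1 / (a - 2))) ≠ 0 := by
  set C := 1 / (a - 2) with hC
  have hC' : a * C = 1 + 2 * C := by rw [hC]; field_simp; ring
  have hC0 : C ≠ 0 := by rw [hC]; exact one_div_ne_zero ha
  have hq : q ≠ 0 := by rintro rfl; simp at h
  intro h0
  have h1 : (w - C) - q * (1 - C) = 0 := by simpa [hq] using h0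
  have : q * C = 0 := by
    have h2 : ((w - C) - q * (1 - C)) * (q * (w - C) - (1 - C)) = - q * C := by
      linear_combination q * hk + (w - C) * (1 - C) * h + q * (w+1-C) * hC' 
    rw [h1] at h2
    linear_combination h2
  simp [hq, hC0] at this

open Polynomial in
/-- The polynomial whose roots give the poles. -/
noncomputable def polePoly (n : ℕ) : Polynomial ℂ :=
  X ^ (2 * n + 1) + X ^ (n + 2) - C 2 * X ^ (n + 1) - C 2 * X ^ n + X ^ (n - 1) + 1

lemma polePoly_coeff (n k : ℕ) : (polePoly n).coeff k =
    (if k = 2 * n + 1 then 1 else 0) + (if k = n + 2 then 1 else 0)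
      - 2 * (if k = n + 1 then 1 else 0) - 2 * (if k = n then 1 else 0)
      + (if k = n - 1 then 1 else 0) + (if k = 0 then 1 else 0) := by
  unfold polePoly
  simp only [Polynomial.coeff_add, Polynomial.coeff_sub, Polynomial.coeff_C_mul,
    Polynomial.coeff_X_pow, Polynomial.coeff_one]

lemma polePoly_natDegree (n : ℕ) (hn : 5 ≤ n) : (polePoly n).natDegree = 2 * n + 1 := by
  apply le_antisymm
  · rw [Polynomial.natDegree_le_iff_coeff_eq_zero]
    intro k hk
    rw [polePoly_coeff]
    simp [show k ≠ 2 * n + 1 by omega, show k ≠ n + 2 by omega, show k ≠ n + 1 by omega,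
      show k ≠ n by omega, show k ≠ n - 1 by omega, show k ≠ 0 by omega]
  · apply Polynomial.le_natDegree_of_ne_zero
    rw [polePoly_coeff]
    simp [show 2 * n ≠ n + 1 by omega, show n ≠ 0 by omega,
      show 2 * n + 1 ≠ n by omega, show 2 * n + 1 ≠ n - 1 by omega]

lemma polePoly_esymm (n : ℕ) (hn : 5 ≤ n) (k : ℕ) (hk : k ≤ 2 * n + 1) :
    (polePoly n).roots.esymm k = (-1) ^ k * (polePoly n).coeff (2 * n + 1 - k) := by
  have h := Polynomial.coeff_eq_esymm_roots_of_splits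
    (IsAlgClosed.splits (polePoly n)) (k := 2 * n + 1 - k)
    (by rw [polePoly_natDegree n hn]; omega)
  rw [h, polePoly_natDegree n hn]
  have h2 : (polePoly n).leadingCoeff = 1 := by
    rw [Polynomial.leadingCoeff, polePoly_natDegree n hn, polePoly_coeff]
    simp [show 2 * n ≠ n + 1 by omega, show n ≠ 0 by omega,
      show 2 * n + 1 ≠ n by omega, show 2 * n + 1 ≠ n - 1 by omega]
  rw [h2, show 2 * n + 1 - (2 * n + 1 - k) = k by omega]
  rw [one_mul, ← mul_assoc, ← mul_pow]; simp

lemma polePoly_esymm_zero (n : ℕ) (hn : 5 ≤ n) (k : ℕ) (hk : 0 < k) (hk' : k < n - 1) :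
    (polePoly n).roots.esymm k = 0 := by
  rw [polePoly_esymm n hn k (by omega), polePoly_coeff]
  simp [show 2 * n + 1 - k ≠ 2 * n + 1 by omega, show 2 * n + 1 - k ≠ n + 2 by omega,
    show 2 * n + 1 - k ≠ n + 1 by omega, show 2 * n + 1 - k ≠ n by omega,
    show 2 * n + 1 - k ≠ n - 1 by omega, show 2 * n + 1 - k ≠ 0 by omega]

lemma newton_roots (s : Multiset ℂ) (k : ℕ) (hk : 0 < k) :
    (s.map (fun x => x ^ k)).sum = (-1) ^ (k + 1) * k * s.esymm k -
      ∑ a ∈ Finset.HasAntidiagonal.antidiagonal k with a.1 ∈ Set.Ioo 0 k,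
        (-1) ^ a.1 * s.esymm a.1 * (s.map (fun x => x ^ a.2)).sum := by
  have h := congrArg (MvPolynomial.aeval (fun x : s => x.1))
    (MvPolynomial.psum_eq_mul_esymm_sub_sum s ℂ k hk)
  have hp : ∀ j, MvPolynomial.aeval (fun x : s => x.1) (MvPolynomial.psum s ℂ j)
      = (s.map (fun x => x ^ j)).sum := by
    intro j
    rw [MvPolynomial.psum, map_sum]
    simp only [map_pow, MvPolynomial.aeval_X]
    rw [Finset.sum_eq_multiset_sum]
    conv_rhs => rw [← Multiset.map_univ_coe s]
    rw [Multiset.map_map]; rfl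
  have he : ∀ j, MvPolynomial.aeval (fun x : s => x.1) (MvPolynomial.esymm s ℂ j)
      = s.esymm j := by
    intro j
    rw [MvPolynomial.aeval_esymm_eq_multiset_esymm]
    rw [Multiset.map_univ_coe s]
  rw [hp, map_sub, map_sum, map_mul, he] at h
  rw [h]
  simp only [map_mul, hp, he, map_pow, map_neg, map_one, map_natCast]

lemma polePoly_psum_zero (n : ℕ) (hn : 5 ≤ n) (k : ℕ) (hk : 0 < k) (hk' : k < n - 1) :
    ((polePoly n).roots.map (fun x => x ^ k)).sum = 0 := by
  rw [newton_roots _ k hk, polePoly_esymm_zero n hn k hk hk', mul_zero, zero_sub, neg_eq_zero]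
  apply Finset.sum_eq_zero
  rintro ⟨i, j⟩ hij
  simp only [Finset.mem_filter, Finset.HasAntidiagonal.mem_antidiagonal, Set.mem_Ioo] at hij
  rw [polePoly_esymm_zero n hn i (by omega) (by omega)]; simp

lemma polePoly_psum (n : ℕ) (hn : 5 ≤ n) :
    ((polePoly n).roots.map (fun x => x ^ (n + 1))).sum = 2 * (n + 1) := by
  rw [newton_roots _ (n + 1) (by omega), Finset.sum_eq_zero]
  · rw [polePoly_esymm n hn _ (by omega), polePoly_coeff]
    simp only [show 2 * n + 1 - (n + 1) = n by omega, show n ≠ 2 * n + 1 by omega,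
      show n ≠ n + 2 by omega, show n ≠ n + 1 by omega, show n ≠ n - 1 by omega,
      show n ≠ 0 by omega, if_true, if_false]
    have : ((-1 : ℂ)) ^ (n + 1 + 1) * (-1) ^ (n + 1) = -1 := by
      rw [pow_succ (-1 : ℂ) (n + 1)]
      have : ((-1 : ℂ)) ^ (n + 1) * (-1) ^ (n + 1) = 1 := by rw [← mul_pow]; simp
      linear_combination -this
    push_cast
    linear_combination (-2 * (n + 1) : ℂ) * this
  · rintro ⟨i, j⟩ hij
    simp only [Finset.mem_filter, Finset.HasAntidiagonal.mem_antidiagonal, Set.mem_Ioo] at hij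
    by_cases hi : i < n - 1
    · rw [polePoly_esymm_zero n hn i (by omega) (by omega)]; simp
    · rw [polePoly_psum_zero n hn j (by omega) (by omega)]; simp

lemma polePoly_ne_zero (n : ℕ) (hn : 5 ≤ n) : polePoly n ≠ 0 := by
  intro h
  have := polePoly_natDegree n hn
  rw [h] at this; simp at this

lemma exists_root_off_circle (n : ℕ) (hn : 5 ≤ n) :
    ∃ q : ℂ, (polePoly n).eval q = 0 ∧ ‖q‖ ≠ 1 := by
  by_contra! hcon
  have hs := polePoly_psum n hn
  have h1 : ‖((polePoly n).roots.map (fun x => x ^ (n + 1))).sum‖ ≤ 2 * n + 1 := by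
    refine (norm_multiset_sum_le _).trans ?_
    rw [Multiset.map_map]
    have : (polePoly n).roots.map (norm ∘ fun x => x ^ (n + 1))
        = (polePoly n).roots.map (fun _ => (1 : ℝ)) := by
      apply Multiset.map_congr rfl
      intro x hx
      have hx' := (Polynomial.mem_roots (polePoly_ne_zero n hn)).1 hx
      simp [hcon x hx']
    rw [this]
    simp only [Multiset.map_const', Multiset.sum_replicate, nsmul_eq_mul, mul_one]
    have := Polynomial.card_roots' (polePoly n)
    rw [polePoly_natDegree n hn] at this
    exact_mod_cast this
  rw [hs] at h1
  have h2 : ‖(2 * ((n : ℂ) + 1))‖ = 2 * (n + 1) := by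
    have : (2 * ((n : ℂ) + 1)) = ((2 * (n + 1) : ℕ) : ℂ) := by push_cast; ring
    rw [this, Complex.norm_natCast]; push_cast; ring
  rw [h2] at h1
  linarith

lemma polePoly_eval (n : ℕ) (q : ℂ) : (polePoly n).eval q =
    q ^ (2 * n + 1) + q ^ (n + 2) - 2 * q ^ (n + 1) - 2 * q ^ n + q ^ (n - 1) + 1 := by
  simp [polePoly]

lemma exists_root_in_disc (n : ℕ) (hn : 5 ≤ n) :
    ∃ q : ℂ, (polePoly n).eval q = 0 ∧ ‖q‖ < 1 ∧ q ≠ 0 := by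
  obtain ⟨q, hq, hq1⟩ := exists_root_off_circle n hn
  have hq0 : q ≠ 0 := by
    rintro rfl
    rw [polePoly_eval] at hq
    simp [show n ≠ 0 by omega, show n - 1 ≠ 0 by omega] at hq
  rcases lt_or_gt_of_ne hq1 with h | h
  · exact ⟨q, hq, h, hq0⟩
  · refine ⟨q⁻¹, ?_, ?_, inv_ne_zero hq0⟩
    · rw [polePoly_eval] at hq ⊢
      obtain ⟨m, rfl⟩ : ∃ m, n = m + 1 := ⟨n - 1, by omega⟩
      simp only [Nat.add_sub_cancel] at hq ⊢
      have : q ^ (2 * (m + 1) + 1) ≠ 0 := pow_ne_zero _ hq0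
      apply mul_left_cancel₀ this
      rw [mul_zero, ← hq]
      simp only [inv_pow]
      have e1 : q ^ (2 * (m + 1) + 1) = q ^ 3 * q ^ m * q ^ m := by ring
      have e2 : q ^ (m + 1 + 2) = q ^ 3 * q ^ m := by ring
      have e3 : q ^ (m + 1 + 1) = q ^ 2 * q ^ m := by ring
      have e4 : q ^ (m + 1) = q * q ^ m := by ring
      have hm : q ^ m ≠ 0 := pow_ne_zero _ hq0
      rw [e1, e2, e3, e4]
      field_simp
      ring
    · rw [norm_inv]; exact inv_lt_one_of_one_lt₀ h

lemma exists_pole_param (n : ℕ) (hn : 5 ≤ n) (hodd : Odd n) :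
    ∃ q : ℂ, q ≠ 0 ∧ ‖q‖ < 1 ∧ (∀ s : ℝ, 0 < s → q ≠ ((-s : ℝ) : ℂ)) ∧
      sSeq (q + 1 / q) (n + 1) = 1 := by
  obtain ⟨q, hq, h1, h0⟩ := exists_root_in_disc n hn
  rw [polePoly_eval] at hq
  obtain ⟨m, rfl⟩ : ∃ m, n = m + 1 := ⟨n - 1, by omega⟩
  simp only [Nat.add_sub_cancel] at hq
  refine ⟨q, h0, h1, ?_, ?_⟩
  · rintro s hs rfl
    have hs1 : s < 1 := by
      rw [Complex.norm_real] at h1; simpa [abs_of_pos hs] using h1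
    have hm : Even m := by
      rcases Nat.even_or_odd m with h | h
      · exact h
      · exfalso; rw [Nat.odd_iff] at *; omega
    have hq' : (-s) ^ (2 * (m + 1) + 1) + (-s) ^ (m + 1 + 2) - 2 * (-s) ^ (m + 1 + 1)
        - 2 * (-s) ^ (m + 1) + (-s) ^ m + 1 = 0 := by exact_mod_cast hq
    have e1 : (-s) ^ (2 * (m + 1) + 1) = - s ^ 3 * s ^ m * s ^ m := by
      rw [show (-s) ^ (2 * (m + 1) + 1) = (-s) ^ 3 * (-s) ^ m * (-s) ^ m by ring, hm.neg_pow]; ring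
    have e2 : (-s) ^ (m + 1 + 2) = - s ^ 3 * s ^ m := by
      rw [show (-s) ^ (m + 1 + 2) = (-s) ^ 3 * (-s) ^ m by ring, hm.neg_pow]; ring
    have e3 : (-s) ^ (m + 1 + 1) = s ^ 2 * s ^ m := by
      rw [show (-s) ^ (m + 1 + 1) = (-s) ^ 2 * (-s) ^ m by ring, hm.neg_pow]; ring
    have e4 : (-s) ^ (m + 1) = - s * s ^ m := by
      rw [show (-s) ^ (m + 1) = (-s) * (-s) ^ m by ring, hm.neg_pow]
    rw [e1, e2, e3, e4, hm.neg_pow] at hq'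
    have hp : 0 < s ^ m := pow_pos hs m
    have hp1 : s ^ m ≤ 1 := pow_le_one₀ hs.le hs1.le
    have h3 : s ^ 3 < 1 := pow_lt_one₀ hs.le hs1 (by norm_num)
    have h2 : s ^ 2 ≤ s := by nlinarith
    have a1 : s ^ 3 * (s ^ m * s ^ m) < 1 := by
      have : s ^ m * s ^ m ≤ 1 := by nlinarith
      have : 0 < s ^ m * s ^ m := by positivity
      nlinarith [pow_pos hs 3]
    nlinarith
  · have ha : (q + 1 / q) * q = q ^ 2 + 1 := by field_simp
    have := sSeq_closed ha (m + 1 + 1)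
    have hne : (1 - q) ^ 2 * (1 + q) * q ^ (m + 1 + 1) ≠ 0 := by
      have h2 : 1 - q ≠ 0 := by
        intro h; rw [← sub_eq_zero.1 h] at h1; simp at h1
      have h3 : 1 + q ≠ 0 := by
        intro h; rw [← neg_eq_of_add_eq_zero_right h] at h1; simp at h1
      exact mul_ne_zero (mul_ne_zero (pow_ne_zero _ h2) h3) (pow_ne_zero _ h0)
    apply mul_right_cancel₀ hne
    rw [this, one_mul]
    have e1 : q ^ (2 * (m + 1) + 1) = q ^ 3 * q ^ m * q ^ m := by ring
    have e2 : q ^ (m + 1 + 2) = q ^ 3 * q ^ m := by ring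
    have e3 : q ^ (m + 1 + 1) = q ^ 2 * q ^ m := by ring
    have e4 : q ^ (m + 1) = q * q ^ m := by ring
    rw [e1, e2, e3, e4] at hq
    rw [e3]
    linear_combination (-q ^ 2) * hq

open Filter Topology

/-- Differentiation with respect to `τ`. -/
noncomputable def tDer (τ g : ℂ → ℂ) : ℂ → ℂ := fun m => deriv g m / deriv τ m

lemma tDer_iter_meromorphic {τ F : ℂ → ℂ} {m : ℂ} (hτ : AnalyticAt ℂ τ m)
    (hF : MeromorphicAt F m) (i : ℕ) : MeromorphicAt ((tDer τ)^[i] F) m := by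
  induction i with
  | zero => simpa using hF
  | succ i ih =>
    rw [Function.iterate_succ_apply']
    exact ih.deriv.div hτ.meromorphicAt.deriv

lemma tDer_iter_base {τ F : ℂ → ℂ} {m : ℂ} (hτ : AnalyticAt ℂ τ m) (hd : deriv τ m ≠ 0)
    {W : Set ℂ} (hW : IsOpen W) (hmW : τ m ∈ W) {f : ℕ → ℂ → ℂ}
    (hf : ∀ i, ∀ t ∈ W, HasDerivAt (f i) (f (i + 1) t) t)
    (hF : F =ᶠ[𝓝 m] fun x => f 0 (τ x)) (i : ℕ) :
    (tDer τ)^[i] F =ᶠ[𝓝 m] fun x => f i (τ x) := by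
  induction i with
  | zero => simpa using hF
  | succ i ih =>
    rw [Function.iterate_succ_apply']
    have h1 : ∀ᶠ x in 𝓝 m, τ x ∈ W := hτ.continuousAt (hW.mem_nhds hmW)
    have h2 : ∀ᶠ x in 𝓝 m, deriv τ x ≠ 0 := hτ.deriv.continuousAt.eventually_ne hd
    filter_upwards [ih.eventuallyEq_nhds, h1, h2, hτ.eventually_analyticAt] with x hx1 hx2 hx3 hx4
    rw [tDer, hx1.deriv_eq]
    have h3 : HasDerivAt (fun x => f i (τ x)) (f (i + 1) (τ x) * deriv τ x) x :=
      (hf i (τ x) hx2).comp x hx4.differentiableAt.hasDerivAt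
    rw [h3.deriv]
    field_simp

lemma tDer_iter_order {τ F : ℂ → ℂ} {m : ℂ} (hτ : AnalyticAt ℂ τ m) (hd : deriv τ m ≠ 0)
    {k : ℤ} (hk : k < 0) (hF : meromorphicOrderAt F m = k) (i : ℕ) :
    meromorphicOrderAt ((tDer τ)^[i] F) m = ((k - i : ℤ) : WithTop ℤ) := by
  have hFm : MeromorphicAt F m :=
    meromorphicAt_of_meromorphicOrderAt_ne_zero (by rw [hF]; exact_mod_cast hk.ne)
  induction i with
  | zero => simpa using hF
  | succ i ih =>
    rw [Function.iterate_succ_apply']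
    have h1 := meromorphicOrderAt_deriv_eq_sub_one (f := (tDer τ)^[i] F) (x := m) (n := k - i)
      (by
        have : (k - i : ℤ) ≠ 0 := by omega
        exact_mod_cast this) ih
    have h2 : meromorphicOrderAt (deriv τ) m = 0 := by
      rw [← tendsto_ne_zero_iff_meromorphicOrderAt_eq_zero hτ.deriv.meromorphicAt]
      exact ⟨_, hd, hτ.deriv.continuousAt.tendsto.mono_left nhdsWithin_le_nhds⟩
    have h3 := meromorphicOrderAt_div (tDer_iter_meromorphic hτ hFm i).deriv
      hτ.deriv.meromorphicAt
    have h4 : tDer τ ((tDer τ)^[i] F) = deriv ((tDer τ)^[i] F) / deriv τ := rfl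
    rw [h4, h3, h1, h2, sub_zero]
    have h5 : k - (i : ℤ) - 1 = k - ((i + 1 : ℕ) : ℤ) := by push_cast; ring
    rw [h5]

theorem no_pole_of_ode {τ F : ℂ → ℂ} {Ω : Set ℂ} (hΩ : IsPreconnected Ω)
    (hτ : ∀ m ∈ Ω, AnalyticAt ℂ τ m) (hF : ∀ m ∈ Ω, MeromorphicAt F m)
    {m₁ : ℂ} (hm₁ : m₁ ∈ Ω) (hd₁ : deriv τ m₁ ≠ 0)
    {W : Set ℂ} (hW : IsOpen W) (hmW : τ m₁ ∈ W) {f : ℕ → ℂ → ℂ}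
    (hf : ∀ i, ∀ t ∈ W, HasDerivAt (f i) (f (i + 1) t) t)
    (hFf : F =ᶠ[𝓝 m₁] fun x => f 0 (τ x))
    {r : ℕ} {P : ℕ → Polynomial ℂ}
    (hode : ∀ t ∈ W, ∑ i ∈ Finset.range (r + 1), (P i).eval t * f i t = 0)
    {m₀ : ℂ} (hm₀ : m₀ ∈ Ω) (hd₀ : deriv τ m₀ ≠ 0) (hP : (P r).eval (τ m₀) ≠ 0)
    (hpole : meromorphicOrderAt F m₀ < 0) : False := by
  set T : ℕ → ℂ → ℂ := fun i m => (P i).eval (τ m) * (tDer τ)^[i] F m with hT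
  have hPa : ∀ i, ∀ m ∈ Ω, AnalyticAt ℂ (fun m => (P i).eval (τ m)) m := by
    intro i m hm
    exact (AnalyticAt.aeval_polynomial (hτ m hm) (P i)).congr
      (Eventually.of_forall fun x => by simp [Polynomial.aeval_def])
  have hTm : ∀ i, ∀ m ∈ Ω, MeromorphicAt (T i) m := fun i m hm =>
    (hPa i m hm).meromorphicAt.mul (tDer_iter_meromorphic (hτ m hm) (hF m hm) i)
  have hSm : ∀ s : ℕ, ∀ m ∈ Ω, MeromorphicAt (fun m => ∑ i ∈ Finset.range s, T i m) m := by
    intro s m hm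
    exact MeromorphicAt.fun_sum (fun i _ => hTm i m hm)
  have htop : meromorphicOrderAt (fun m => ∑ i ∈ Finset.range (r + 1), T i m) m₁ = ⊤ := by
    rw [meromorphicOrderAt_eq_top_iff]
    apply Filter.Eventually.filter_mono nhdsWithin_le_nhds
    have h1 : ∀ᶠ x in 𝓝 m₁, τ x ∈ W := (hτ m₁ hm₁).continuousAt (hW.mem_nhds hmW)
    have h2 : ∀ᶠ x in 𝓝 m₁, ∀ i ∈ Finset.range (r + 1), (tDer τ)^[i] F x = f i (τ x) := by
      rw [Filter.eventually_all_finset]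
      intro i _
      exact tDer_iter_base (hτ m₁ hm₁) hd₁ hW hmW hf hFf i
    filter_upwards [h1, h2] with x hx1 hx2
    rw [← hode _ hx1]
    apply Finset.sum_congr rfl
    intro i hi
    simp only [hT]
    rw [hx2 i hi]
  obtain ⟨k, hk⟩ : ∃ k : ℤ, meromorphicOrderAt F m₀ = k := by
    cases h : meromorphicOrderAt F m₀ with
    | top => rw [h] at hpole; simp at hpole
    | coe k => exact ⟨k, rfl⟩
  have hk0 : k < 0 := by rw [hk] at hpole; exact_mod_cast hpole
  have hord := tDer_iter_order (hτ m₀ hm₀) hd₀ hk0 hk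
  have hTord : ∀ i : ℕ, ((k - i : ℤ) : WithTop ℤ) ≤ meromorphicOrderAt (T i) m₀ := by
    intro i
    have := meromorphicOrderAt_mul (hPa i m₀ hm₀).meromorphicAt
      (tDer_iter_meromorphic (hτ m₀ hm₀) (hF m₀ hm₀) i)
    have e : T i = (fun m => (P i).eval (τ m)) * (tDer τ)^[i] F := rfl
    rw [e, this, hord]
    exact le_add_of_nonneg_left (hPa i m₀ hm₀).meromorphicOrderAt_nonneg
  have hTr : meromorphicOrderAt (T r) m₀ = ((k - r : ℤ) : WithTop ℤ) := by
    have := meromorphicOrderAt_mul_of_ne_zero (f := (tDer τ)^[r] F) (hPa r m₀ hm₀) hP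
    have e : T r = (fun m => (P r).eval (τ m)) * (tDer τ)^[r] F := rfl
    rw [e, this, hord]
  have hlt : ∀ s ≤ r, ((k - r : ℤ) : WithTop ℤ) <
      meromorphicOrderAt (fun m => ∑ i ∈ Finset.range s, T i m) m₀ := by
    intro s hs
    induction s with
    | zero =>
      have : meromorphicOrderAt (fun m : ℂ => ∑ i ∈ Finset.range 0, T i m) m₀ = ⊤ := by
        rw [meromorphicOrderAt_eq_top_iff]; simp
      rw [this]; exact WithTop.coe_lt_top _
    | succ s ih =>
      have e : (fun m => ∑ i ∈ Finset.range (s + 1), T i m)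
          = (fun m => ∑ i ∈ Finset.range s, T i m) + T s := by
        ext m; simp [Finset.sum_range_succ]
      rw [e]
      refine lt_of_lt_of_le ?_ (meromorphicOrderAt_add (hSm s m₀ hm₀) (hTm s m₀ hm₀))
      refine lt_min (ih (by omega)) (lt_of_lt_of_le ?_ (hTord s))
      have : k - r < k - s := by omega
      exact_mod_cast this
  have hfin : meromorphicOrderAt (fun m => ∑ i ∈ Finset.range (r + 1), T i m) m₀
      = ((k - r : ℤ) : WithTop ℤ) := by
    have e : (fun m => ∑ i ∈ Finset.range (r + 1), T i m)
          = (fun m => ∑ i ∈ Finset.range r, T i m) + T r := by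
        ext m; simp [Finset.sum_range_succ]
    rw [e, meromorphicOrderAt_add_eq_right_of_lt (hSm r m₀ hm₀) (by rw [hTr]; exact hlt r le_rfl),
      hTr]
  have hmo : MeromorphicOn (fun m => ∑ i ∈ Finset.range (r + 1), T i m) Ω :=
    fun m hm => hSm (r + 1) m hm
  exact hmo.meromorphicOrderAt_ne_top_of_isPreconnected hΩ hm₀ hm₁
    (by rw [hfin]; exact WithTop.coe_ne_top) htop

open Filter Topology

lemma coeff_derivFun (φ : PowerSeries ℚ) (n : ℕ) :
    PowerSeries.coeff n (PowerSeries.derivativeFun φ) = PowerSeries.coeff (n + 1) φ * (n + 1) := by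
  exact PowerSeries.coeff_derivative φ n

/-- Evaluation of a power series with rational coefficients at a complex number. -/
noncomputable def evPS (φ : PowerSeries ℚ) (t : ℂ) : ℂ :=
  ∑' n, ((PowerSeries.coeff n φ : ℚ) : ℂ) * t ^ n

/-- Coefficients growing at most like `n ^ j * 4 ^ n`. -/
def TamePS (φ : PowerSeries ℚ) : Prop :=
  ∃ (K : ℝ) (j : ℕ), 0 ≤ K ∧
    ∀ n, ‖((PowerSeries.coeff n φ : ℚ) : ℂ)‖ ≤ K * ((n + 1 : ℝ) ^ j * 4 ^ n)

lemma summable_aux (j : ℕ) {r : ℝ} (h0 : 0 < r) (h1 : r < 1) :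
    Summable (fun n : ℕ => (n + 1 : ℝ) ^ j * r ^ n) := by
  have h := summable_pow_mul_geometric_of_norm_lt_one j
    (show ‖r‖ < 1 by rw [Real.norm_of_nonneg h0.le]; exact h1)
  have h2 := ((summable_nat_add_iff 1).2 h).mul_right r⁻¹
  refine h2.congr (fun n => ?_)
  push_cast
  field_simp
  ring

lemma TamePS.summable {φ : PowerSeries ℚ} (h : TamePS φ) {t : ℂ} (ht : ‖t‖ < 1 / 4) :
    Summable (fun n => ‖((PowerSeries.coeff n φ : ℚ) : ℂ) * t ^ n‖) := by
  obtain ⟨K, j, hK, hb⟩ := h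
  obtain ⟨r, hr1, hr2⟩ := exists_between ht
  have hr0 : 0 < r := lt_of_le_of_lt (norm_nonneg _) hr1
  have hs := (summable_aux j (r := 4 * r) (by linarith) (by linarith)).mul_left K
  refine Summable.of_nonneg_of_le (fun n => norm_nonneg _) (fun n => ?_) hs
  rw [norm_mul, norm_pow, mul_pow]
  have : ‖t‖ ^ n ≤ r ^ n := pow_le_pow_left₀ (norm_nonneg _) hr1.le n
  calc _ ≤ (K * ((n + 1 : ℝ) ^ j * 4 ^ n)) * r ^ n := by
        apply mul_le_mul (hb n) this (by positivity) (by positivity)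
    _ = _ := by ring

lemma TamePS.deriv {φ : PowerSeries ℚ} (h : TamePS φ) : TamePS (PowerSeries.derivativeFun φ) := by
  obtain ⟨K, j, hK, hb⟩ := h
  refine ⟨K * 2 ^ j * 4, j + 1, by positivity, fun n => ?_⟩
  rw [coeff_derivFun]
  push_cast
  rw [norm_mul]
  have h1 : ‖(n : ℂ) + 1‖ = n + 1 := by
    have : ((n : ℂ) + 1) = ((n + 1 : ℕ) : ℂ) := by push_cast; ring
    rw [this, Complex.norm_natCast]; push_cast; ring
  rw [h1]
  have h2 := hb (n + 1)
  push_cast at h2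
  have h3 : ((n : ℝ) + 1 + 1) ^ j ≤ 2 ^ j * (n + 1) ^ j := by
    rw [← mul_pow]
    apply pow_le_pow_left₀ (by positivity)
    have : (0 : ℝ) ≤ n := by positivity
    linarith
  calc _ ≤ (K * (((n : ℝ) + 1 + 1) ^ j * 4 ^ (n + 1))) * (n + 1) := by
        apply mul_le_mul_of_nonneg_right h2 (by positivity)
    _ ≤ (K * ((2 ^ j * (n + 1) ^ j) * 4 ^ (n + 1))) * (n + 1) := by gcongr
    _ = _ := by ring

lemma evPS_hasDerivAt {φ : PowerSeries ℚ} (h : TamePS φ) {t : ℂ} (ht : ‖t‖ < 1 / 4) :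
    HasDerivAt (evPS φ) (evPS (PowerSeries.derivativeFun φ) t) t := by
  have hsum := h.summable ht
  obtain ⟨K, j, hK, hb⟩ := h
  obtain ⟨r, hr1, hr2⟩ := exists_between ht
  have hr0 : 0 < r := lt_of_le_of_lt (norm_nonneg _) hr1
  have hs := (summable_aux (j + 1) (r := 4 * r) (by linarith) (by linarith)).mul_left (K * r⁻¹)
  have key := hasDerivAt_tsum_of_isPreconnected (u := fun n : ℕ => K * r⁻¹ *
      ((n + 1 : ℝ) ^ (j + 1) * (4 * r) ^ n)) (t := Metric.ball (0 : ℂ) r)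
      (g := fun n y => ((PowerSeries.coeff n φ : ℚ) : ℂ) * y ^ n)
      (g' := fun n y => ((PowerSeries.coeff n φ : ℚ) : ℂ) * (n * y ^ (n - 1)))
      (y₀ := t) (y := t) hs Metric.isOpen_ball (convex_ball _ _).isPreconnected
      (fun n y _ => (hasDerivAt_pow n y).const_mul _) (fun n y hy => ?_)
      (by simpa using hr1) hsum.of_norm (by simpa using hr1)
  · have e : evPS (PowerSeries.derivativeFun φ) t
        = ∑' n, ((PowerSeries.coeff n φ : ℚ) : ℂ) * (n * t ^ (n - 1)) := by
      rw [tsum_eq_zero_add']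
      · unfold evPS
        simp only [Nat.cast_zero, zero_mul, mul_zero, zero_add]
        apply tsum_congr
        intro n
        rw [coeff_derivFun]
        rw [Nat.add_sub_cancel]
        push_cast
        ring
      · have := (TamePS.deriv ⟨K, j, hK, hb⟩ : TamePS (PowerSeries.derivativeFun φ)).summable ht
        refine this.of_norm.congr (fun n => ?_)
        rw [coeff_derivFun]
        rw [Nat.add_sub_cancel]
        push_cast
        ring
    rw [e]
    exact key
  · have hy' : ‖y‖ ≤ r := by have := mem_ball_zero_iff.1 hy; exact this.le
    rw [norm_mul, norm_mul, Complex.norm_natCast, norm_pow]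
    rcases n with _ | n
    · simp; positivity
    · simp only [Nat.add_sub_cancel]
      have h2 := hb (n + 1)
      have h3 : ‖y‖ ^ n ≤ r ^ n := pow_le_pow_left₀ (norm_nonneg _) hy' n
      calc _ ≤ (K * ((((n + 1 : ℕ) : ℝ) + 1) ^ j * 4 ^ (n + 1))) *
            ((((n + 1 : ℕ) : ℝ) + 1) * r ^ n) := by
            apply mul_le_mul h2 _ (by positivity) (by positivity)
            apply mul_le_mul _ h3 (by positivity) (by positivity)
            linarith
        _ = _ := by rw [mul_pow]; field_simp; ring

lemma evPS_poly_mul {φ : PowerSeries ℚ} (h : TamePS φ) {t : ℂ} (ht : ‖t‖ < 1 / 4)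
    (p : Polynomial ℚ) :
    Summable (fun n => ((PowerSeries.coeff n ((p : PowerSeries ℚ) * φ) : ℚ) : ℂ) * t ^ n) ∧
    evPS ((p : PowerSeries ℚ) * φ) t = (p.map (algebraMap ℚ ℂ)).eval t * evPS φ t := by
  have hz : ∀ n ∉ Finset.range (p.natDegree + 1),
      ((PowerSeries.coeff n (p : PowerSeries ℚ) : ℚ) : ℂ) * t ^ n = 0 := by
    intro n hn
    rw [Polynomial.coeff_coe, Polynomial.coeff_eq_zero_of_natDegree_lt]
    · simp
    · simp at hn; omega
  have hp : Summable (fun n => ‖((PowerSeries.coeff n (p : PowerSeries ℚ) : ℚ) : ℂ) * t ^ n‖) :=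
    summable_of_ne_finset_zero (s := Finset.range (p.natDegree + 1))
      (fun n hn => by rw [hz n hn, norm_zero])
  have hpe : ∑' n, ((PowerSeries.coeff n (p : PowerSeries ℚ) : ℚ) : ℂ) * t ^ n
      = (p.map (algebraMap ℚ ℂ)).eval t := by
    rw [tsum_eq_sum hz, Polynomial.eval_map, Polynomial.eval₂_eq_sum_range]
    apply Finset.sum_congr rfl
    intro n _
    rw [Polynomial.coeff_coe]; rfl
  have e : ∀ n, ((PowerSeries.coeff n ((p : PowerSeries ℚ) * φ) : ℚ) : ℂ) * t ^ n
      = ∑ kl ∈ Finset.HasAntidiagonal.antidiagonal n,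
        (((PowerSeries.coeff kl.1 (p : PowerSeries ℚ) : ℚ) : ℂ) * t ^ kl.1) *
        (((PowerSeries.coeff kl.2 φ : ℚ) : ℂ) * t ^ kl.2) := by
    intro n
    rw [PowerSeries.coeff_mul, Rat.cast_sum, Finset.sum_mul]
    apply Finset.sum_congr rfl
    rintro ⟨k, l⟩ hkl
    rw [Finset.HasAntidiagonal.mem_antidiagonal] at hkl
    simp only at hkl ⊢
    rw [← hkl, pow_add]; push_cast; ring
  constructor
  · exact (summable_norm_sum_mul_antidiagonal_of_summable_norm hp (h.summable ht)).of_norm.congr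
      (fun n => (e n).symm)
  · unfold evPS
    rw [tsum_congr e, ← hpe,
      tsum_mul_tsum_eq_tsum_sum_antidiagonal_of_summable_norm hp (h.summable ht)]

lemma evPS_ode {φ : PowerSeries ℚ} (h : TamePS φ) {r : ℕ} {p : ℕ → Polynomial ℚ}
    (hode : ∑ i ∈ Finset.range (r + 1),
        (p i : PowerSeries ℚ) * (PowerSeries.derivativeFun^[i] φ) = 0)
    {t : ℂ} (ht : ‖t‖ < 1 / 4) :
    ∑ i ∈ Finset.range (r + 1), ((p i).map (algebraMap ℚ ℂ)).eval t *
      evPS (PowerSeries.derivativeFun^[i] φ) t = 0 := by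
  have hT : ∀ i, TamePS (PowerSeries.derivativeFun^[i] φ) := by
    intro i
    induction i with
    | zero => simpa using h
    | succ i ih => rw [Function.iterate_succ_apply']; exact ih.deriv
  rw [Finset.sum_congr rfl (fun i _ => ((evPS_poly_mul (hT i) ht (p i)).2).symm)]
  unfold evPS
  rw [← Summable.tsum_finsetSum (fun i _ => (evPS_poly_mul (hT i) ht (p i)).1)]
  rw [← tsum_zero (β := ℕ)]
  apply tsum_congr
  intro n
  have := congrArg (fun ψ => ((PowerSeries.coeff n ψ : ℚ) : ℂ)) hode
  simp only [map_sum, map_zero, Rat.cast_sum, Rat.cast_zero] at this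
  rw [← Finset.sum_mul, this, zero_mul]

/-- The step set. -/
def stepB : Finset (ℤ × ℤ) := {(-1,1),(0,1),(1,0),(1,-1)}

/-- All partial sums stay in the quarter plane. -/
def QPcond {n : ℕ} (f : Fin n → ℤ × ℤ) : Prop :=
  ∀ k : Fin n, 0 ≤ ∑ j ∈ Finset.Iic k, (f j).1 ∧ 0 ≤ ∑ j ∈ Finset.Iic k, (f j).2

open Classical in
/-- The finite set of walks of length `n`. -/
noncomputable def walkSet (n : ℕ) : Finset (Fin n → ℤ × ℤ) :=
  (Fintype.piFinset fun _ => stepB).filter QPcond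

lemma mem_walkSet {n : ℕ} {f : Fin n → ℤ × ℤ} :
    f ∈ walkSet n ↔ (∀ k, f k ∈ stepB) ∧ QPcond f := by
  simp [walkSet, Fintype.mem_piFinset]

lemma card_walkSet (n : ℕ) : quarterPlaneWalks stepB n = (walkSet n).card := by
  unfold quarterPlaneWalks
  rw [← Nat.card_eq_finsetCard]
  apply Nat.card_congr
  exact Equiv.subtypeEquivRight (fun f => mem_walkSet.symm)

lemma card_walkSet_le (n : ℕ) : (walkSet n).card ≤ 4 ^ n := by
  classical
  unfold walkSet
  refine (Finset.card_filter_le _ _).trans ?_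
  rw [Fintype.card_piFinset]
  simp [stepB]

lemma QPcond_snoc {n : ℕ} (f : Fin n → ℤ × ℤ) (s : ℤ × ℤ) :
    QPcond (Fin.snoc f s : Fin (n + 1) → ℤ × ℤ) ↔
      QPcond f ∧ 0 ≤ ∑ j, (f j).1 + s.1 ∧ 0 ≤ ∑ j, (f j).2 + s.2 := by
  unfold QPcond
  rw [Fin.forall_fin_succ']
  have h1 : ∀ k : Fin n, Finset.Iic (Fin.castSucc k) = (Finset.Iic k).map Fin.castSuccEmb := by
    intro k; simp
  have h2 : Finset.Iic (Fin.last n) = Finset.univ := by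
    ext x; simp [Fin.le_last]
  simp only [h1, Finset.sum_map, h2, Fin.sum_univ_castSucc, Fin.coe_castSuccEmb,
    Fin.snoc_castSucc, Fin.snoc_last]

lemma endpoint_nonneg {n : ℕ} {f : Fin n → ℤ × ℤ} (h : QPcond f) :
    0 ≤ ∑ j, (f j).1 ∧ 0 ≤ ∑ j, (f j).2 := by
  rcases n with _ | n
  · simp
  · have := h (Fin.last n)
    have h2 : Finset.Iic (Fin.last n) = Finset.univ := by
      ext x; simp [Fin.le_last]
    rwa [h2] at this

lemma sum_walkSet_succ (n : ℕ) (g : ℤ → ℤ → ℂ) :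
    ∑ f ∈ walkSet (n + 1), g (∑ j, (f j).1) (∑ j, (f j).2) =
      ∑ f ∈ walkSet n, ∑ s ∈ stepB with
        (0 ≤ ∑ j, (f j).1 + s.1 ∧ 0 ≤ ∑ j, (f j).2 + s.2),
        g (∑ j, (f j).1 + s.1) (∑ j, (f j).2 + s.2) := by
  rw [Finset.sum_sigma']
  refine Finset.sum_bij' (fun f _ => ⟨Fin.init f, f (Fin.last n)⟩)
    (fun p _ => Fin.snoc p.1 p.2) ?_ ?_ ?_ ?_ ?_
  · intro f hf
    rw [mem_walkSet, ← Fin.snoc_init_self f, QPcond_snoc] at hf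
    simp only [Finset.mem_sigma, Finset.mem_filter, mem_walkSet]
    refine ⟨⟨fun k => ?_, hf.2.1⟩, ?_, hf.2.2⟩
    · simpa using hf.1 (Fin.castSucc k)
    · simpa using hf.1 (Fin.last n)
  · rintro ⟨f, s⟩ hf
    simp only [Finset.mem_sigma, Finset.mem_filter, mem_walkSet] at hf
    rw [mem_walkSet, QPcond_snoc]
    refine ⟨?_, hf.1.2, hf.2.2⟩
    rw [Fin.forall_fin_succ']
    simp only [Fin.snoc_castSucc, Fin.snoc_last]
    exact ⟨hf.1.1, hf.2.1⟩
  · intro f hf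
    simp
  · rintro ⟨f, s⟩ hf
    simp
  · intro f hf
    simp only [Fin.sum_univ_castSucc]
    rfl

/-- Bivariate polynomial counting walks of length `n` by endpoint. -/
noncomputable def endPoly (n : ℕ) (x y : ℂ) : ℂ :=
  ∑ f ∈ walkSet n, x ^ (∑ j, (f j).1).toNat * y ^ (∑ j, (f j).2).toNat

lemma step_identity (x y : ℂ) (i j : ℤ) (hi : 0 ≤ i) (hj : 0 ≤ j) :
    x * y * (∑ s ∈ stepB with (0 ≤ i + s.1 ∧ 0 ≤ j + s.2),
      x ^ (i + s.1).toNat * y ^ (j + s.2).toNat) =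
    (y ^ 2 + x * y ^ 2 + x ^ 2 * y + x ^ 2) * (x ^ i.toNat * y ^ j.toNat)
      - y ^ 2 * ((0 : ℂ) ^ i.toNat * y ^ j.toNat) - x ^ 2 * (x ^ i.toNat * (0 : ℂ) ^ j.toNat) := by
  lift i to ℕ using hi
  lift j to ℕ using hj
  rw [Finset.sum_filter]
  have hS : ∀ F : ℤ × ℤ → ℂ, ∑ s ∈ stepB, F s = F (-1,1) + F (0,1) + F (1,0) + F (1,-1) := by
    intro F
    simp [stepB, Finset.sum_insert]; ring
  rw [hS]
  have t1 : ∀ k : ℕ, ((k : ℤ) + 1).toNat = k + 1 := by intro k; omega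
  have t2 : ∀ k : ℕ, (((k + 1 : ℕ) : ℤ) + -1).toNat = k := by intro k; omega
  have p1 : ∀ k : ℕ, 0 ≤ ((k : ℤ) + 1) := by intro k; omega
  have p2 : ∀ k : ℕ, 0 ≤ (((k + 1 : ℕ) : ℤ) + -1) := by intro k; omega
  have p3 : ∀ k : ℕ, 0 ≤ (k : ℤ) := by intro k; omega
  simp only [add_zero, t1, p1, p3, and_true, true_and, if_true, Int.toNat_natCast]
  rcases i with _ | i <;> rcases j with _ | j
  · norm_num; ring
  · rw [if_pos (p2 j), t2]; norm_num; ring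
  · rw [if_pos (p2 i), t2]; norm_num; ring
  · rw [if_pos (p2 i), if_pos (p2 j), t2, t2]; simp; ring

lemma endPoly_succ (n : ℕ) (x y : ℂ) :
    x * y * endPoly (n + 1) x y = (y ^ 2 + x * y ^ 2 + x ^ 2 * y + x ^ 2) * endPoly n x y
      - y ^ 2 * endPoly n 0 y - x ^ 2 * endPoly n x 0 := by
  unfold endPoly
  rw [sum_walkSet_succ n (fun i j => x ^ i.toNat * y ^ j.toNat), Finset.mul_sum]
  simp only [Finset.mul_sum]
  rw [← Finset.sum_sub_distrib, ← Finset.sum_sub_distrib]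
  apply Finset.sum_congr rfl
  intro f hf
  obtain ⟨h1, h2⟩ := endpoint_nonneg (mem_walkSet.1 hf).2
  rw [← step_identity x y _ _ h1 h2, Finset.mul_sum]

lemma endPoly_zero (x y : ℂ) : endPoly 0 x y = 1 := by
  have : walkSet 0 = Finset.univ := by
    ext f; simp [mem_walkSet, QPcond]; exact Subsingleton.elim _ _
  simp [endPoly, this]

lemma endPoly_one (n : ℕ) : endPoly n 1 1 = (quarterPlaneWalks stepB n : ℂ) := by
  rw [card_walkSet]; simp [endPoly]

lemma endPoly_norm (n : ℕ) {x y : ℂ} (hx : ‖x‖ ≤ 1) (hy : ‖y‖ ≤ 1) :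
    ‖endPoly n x y‖ ≤ 4 ^ n := by
  unfold endPoly
  refine (norm_sum_le _ _).trans ?_
  have : ∀ f ∈ walkSet n, ‖x ^ (∑ j, (f j).1).toNat * y ^ (∑ j, (f j).2).toNat‖ ≤ 1 := by
    intro f _
    rw [norm_mul, norm_pow, norm_pow]
    exact mul_le_one₀ (pow_le_one₀ (norm_nonneg _) hx) (by positivity)
      (pow_le_one₀ (norm_nonneg _) hy)
  refine (Finset.sum_le_sum this).trans ?_
  simp only [Finset.sum_const, nsmul_eq_mul, mul_one]
  exact_mod_cast card_walkSet_le n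

/-- The trivariate generating function. -/
noncomputable def bigQ (t x y : ℂ) : ℂ := ∑' n, endPoly n x y * t ^ n

lemma bigQ_summable {t x y : ℂ} (ht : ‖t‖ < 1 / 4) (hx : ‖x‖ ≤ 1) (hy : ‖y‖ ≤ 1) :
    Summable (fun n => endPoly n x y * t ^ n) := by
  have hs := summable_geometric_of_lt_one (r := 4 * ‖t‖) (by positivity) (by linarith)
  refine Summable.of_norm_bounded hs (fun n => ?_)
  rw [norm_mul, norm_pow, mul_pow]
  exact mul_le_mul_of_nonneg_right (endPoly_norm n hx hy) (by positivity)

lemma bigQ_bound {t x y : ℂ} (ht : ‖t‖ < 1 / 4) (hx : ‖x‖ ≤ 1) (hy : ‖y‖ ≤ 1) :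
    ‖bigQ t x y‖ ≤ (1 - 4 * ‖t‖)⁻¹ := by
  have hs := hasSum_geometric_of_lt_one (r := 4 * ‖t‖) (by positivity) (by linarith)
  refine tsum_of_norm_bounded hs (fun n => ?_)
  rw [norm_mul, norm_pow, mul_pow]
  exact mul_le_mul_of_nonneg_right (endPoly_norm n hx hy) (by positivity)

lemma bigQ_functional {t x y : ℂ} (ht : ‖t‖ < 1 / 4) (hx : ‖x‖ ≤ 1) (hy : ‖y‖ ≤ 1) :
    x * y * bigQ t x y = x * y + t * (y ^ 2 + x * y ^ 2 + x ^ 2 * y + x ^ 2) * bigQ t x y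
      - t * y ^ 2 * bigQ t 0 y - t * x ^ 2 * bigQ t x 0 := by
  have h0 : ‖(0 : ℂ)‖ ≤ 1 := by simp
  have s1 := bigQ_summable ht hx hy
  have s2 := bigQ_summable ht h0 hy
  have s3 := bigQ_summable ht hx h0
  have e1 : bigQ t x y = 1 + ∑' n, endPoly (n + 1) x y * t ^ (n + 1) := by
    unfold bigQ
    rw [s1.tsum_eq_zero_add, endPoly_zero]; simp
  have e2 : x * y * ∑' n, endPoly (n + 1) x y * t ^ (n + 1)
      = t * (y ^ 2 + x * y ^ 2 + x ^ 2 * y + x ^ 2) * bigQ t x y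
      - t * y ^ 2 * bigQ t 0 y - t * x ^ 2 * bigQ t x 0 := by
    unfold bigQ
    rw [← tsum_mul_left, ← tsum_mul_left, ← tsum_mul_left, ← tsum_mul_left,
      ← (s1.mul_left _).tsum_sub (s2.mul_left _),
      ← ((s1.mul_left _).sub (s2.mul_left _)).tsum_sub (s3.mul_left _)]
    apply tsum_congr
    intro n
    rw [pow_succ]
    linear_combination (t ^ n * t) * endPoly_succ n x y
  linear_combination (x * y) * e1 + e2

lemma bigQ_kernel {t x y : ℂ} (ht : ‖t‖ < 1 / 4) (hx : ‖x‖ ≤ 1) (hy : ‖y‖ ≤ 1)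
    (hk : t * (y ^ 2 + x * y ^ 2 + x ^ 2 * y + x ^ 2) = x * y) :
    t * y ^ 2 * bigQ t 0 y + t * x ^ 2 * bigQ t x 0 = x * y := by
  have := bigQ_functional ht hx hy
  rw [hk] at this
  linear_combination this

lemma bigQ_one (t : ℂ) : bigQ t 1 1 = evPS (walkGF stepB) t := by
  unfold bigQ evPS walkGF
  apply tsum_congr
  intro n
  rw [endPoly_one, PowerSeries.coeff_mk]; push_cast; ring

lemma walkGF_tame : TamePS (walkGF stepB) := by
  refine ⟨1, 0, by norm_num, fun n => ?_⟩
  rw [walkGF, PowerSeries.coeff_mk, card_walkSet]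
  push_cast
  rw [Complex.norm_natCast]
  have := card_walkSet_le n
  have h : ((walkSet n).card : ℝ) ≤ 4 ^ n := by exact_mod_cast this
  simpa using h

open Filter Topology

lemma q_close {a a0 q q0 : ℂ} (h : a * q = q ^ 2 + 1) (h0 : a0 * q0 = q0 ^ 2 + 1)
    (hq : ‖q‖ < 1) (hq0 : ‖q0‖ < 1) : ‖q - q0‖ * (1 - ‖q0‖) ≤ ‖a - a0‖ := by
  have e : (a - a0) * (q * q0) = (q - q0) * (q * q0 - 1) := by
    linear_combination q0 * h - q * h0
  have e' := congrArg norm e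
  rw [norm_mul, norm_mul (q - q0)] at e'
  have h1 : 1 - ‖q0‖ ≤ ‖q * q0 - 1‖ := by
    have := norm_sub_norm_le (1 : ℂ) (q * q0)
    rw [norm_sub_rev] at this
    rw [norm_mul, norm_one] at this
    nlinarith [norm_nonneg q, norm_nonneg q0]
  have h2 : ‖q * q0‖ ≤ 1 := by
    rw [norm_mul]; nlinarith [norm_nonneg q, norm_nonneg q0]
  calc ‖q - q0‖ * (1 - ‖q0‖) ≤ ‖q - q0‖ * ‖q * q0 - 1‖ := by gcongr
    _ = ‖a - a0‖ * ‖q * q0‖ := e'.symm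
    _ ≤ ‖a - a0‖ * 1 := by gcongr
    _ = _ := mul_one _

/-- Locally uniform exponential growth of the iterates. -/
lemma zSeq_growth {a w : ℂ → ℂ} {m0 : ℂ} (ha : ContinuousAt a m0) (hw : ContinuousAt w m0)
    (hk : w m0 ^ 2 + w m0 + 2 = a m0 * w m0)
    (hq : ∀ᶠ m in 𝓝 m0, ∃ q : ℂ, ‖q‖ < 1 ∧ a m * q = q ^ 2 + 1)
    (ha2 : a m0 - 2 ≠ 0) :
    ∃ (ρ c : ℝ) (N : ℕ), 0 < ρ ∧ ρ < 1 ∧ 0 < c ∧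
      ∀ᶠ m in 𝓝 m0, ∀ k, N ≤ k → c ≤ ‖zSeq (a m) (w m) k‖ * ρ ^ k := by
  obtain ⟨q0, hq0, hq0'⟩ := hq.self_of_nhds
  have hch : ∀ m, ∃ q : ℂ, (∃ q : ℂ, ‖q‖ < 1 ∧ a m * q = q ^ 2 + 1) →
      ‖q‖ < 1 ∧ a m * q = q ^ 2 + 1 := by
    intro m
    by_cases h : ∃ q : ℂ, ‖q‖ < 1 ∧ a m * q = q ^ 2 + 1
    · exact ⟨h.choose, fun _ => h.choose_spec⟩
    · exact ⟨0, fun h' => absurd h' h⟩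
  choose q hqs using hch
  have hq' : ∀ᶠ m in 𝓝 m0, ‖q m‖ < 1 ∧ a m * q m = q m ^ 2 + 1 :=
    hq.mono fun m hm => hqs m hm
  have hqt : Tendsto q (𝓝 m0) (𝓝 q0) := by
    rw [tendsto_iff_norm_sub_tendsto_zero]
    have h1 : Tendsto (fun m => ‖a m - a m0‖ / (1 - ‖q0‖)) (𝓝 m0) (𝓝 0) := by
      have := ((tendsto_iff_norm_sub_tendsto_zero.1 ha).div_const (1 - ‖q0‖))
      simpa using this
    refine squeeze_zero' (Eventually.of_forall fun _ => norm_nonneg _) ?_ h1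
    filter_upwards [hq'] with m hm
    rw [le_div_iff₀ (by linarith)]
    exact q_close hm.2 hq0' hm.1 hq0
  set e0 := q0 * ((w m0 - 1 / (a m0 - 2)) - q0 * (1 - 1 / (a m0 - 2))) with he0
  have he0ne : e0 ≠ 0 := grow_coeff_ne ha2 hq0' hk
  have hC : Tendsto (fun m => 1 / (a m - 2)) (𝓝 m0) (𝓝 (1 / (a m0 - 2))) :=
    tendsto_const_nhds.div (ha.tendsto.sub tendsto_const_nhds) ha2
  have hE : Tendsto (fun m => q m * ((w m - 1 / (a m - 2)) - q m * (1 - 1 / (a m - 2))))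
      (𝓝 m0) (𝓝 e0) :=
    hqt.mul ((hw.tendsto.sub hC).sub (hqt.mul (tendsto_const_nhds.sub hC)))
  have hE' : Tendsto (fun m => q m * (w m - 1 / (a m - 2)) - (1 - 1 / (a m - 2)))
      (𝓝 m0) (𝓝 (q0 * (w m0 - 1 / (a m0 - 2)) - (1 - 1 / (a m0 - 2)))) :=
    (hqt.mul (hw.tendsto.sub hC)).sub (tendsto_const_nhds.sub hC)
  set B1 := ‖q0 * (w m0 - 1 / (a m0 - 2)) - (1 - 1 / (a m0 - 2))‖ + 1
  set B2 := ‖1 / (a m0 - 2)‖ + 1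
  have hB1 : 0 ≤ B1 := by positivity
  have hB2 : 0 ≤ B2 := by positivity
  have he0p : 0 < ‖e0‖ := norm_pos_iff.2 he0ne
  obtain ⟨ρ, hρ1, hρ2⟩ := exists_between hq0
  have hρ0 : 0 < ρ := (norm_nonneg _).trans_lt hρ1
  have hlim : Tendsto (fun k : ℕ => B1 * ρ ^ k + 2 * (B2 * ρ ^ k)) atTop (𝓝 0) := by
    have := tendsto_pow_atTop_nhds_zero_of_lt_one hρ0.le hρ2
    simpa using (this.const_mul B1).add ((this.const_mul B2).const_mul 2)
  obtain ⟨N, hN⟩ := eventually_atTop.1 (hlim.eventually (gt_mem_nhds (show 0 < ‖e0‖ / 4 by linarith)))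
  refine ⟨ρ, ‖e0‖ / 8, N, hρ0, hρ2, by linarith, ?_⟩
  filter_upwards [hq', hqt.norm.eventually (gt_mem_nhds hρ1),
    hE.norm.eventually (lt_mem_nhds (show ‖e0‖ / 2 < ‖e0‖ by linarith)),
    hE'.norm.eventually (gt_mem_nhds (show _ < B1 by simp [B1])),
    hC.norm.eventually (gt_mem_nhds (show _ < B2 by simp [B2])),
    (ha.tendsto.sub_const 2).eventually_ne ha2] with m h1 h2 h3 h4 h5 h6 k hk
  have hcl := zSeq_closed (w := w m) h6 h1.2 k
  set z := zSeq (a m) (w m) k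
  set C := 1 / (a m - 2)
  set E := q m * ((w m - C) - q m * (1 - C))
  set E' := q m * (w m - C) - (1 - C)
  clear_value z C E E'
  have hqk : ‖q m‖ ^ k ≤ ρ ^ k := pow_le_pow_left₀ (norm_nonneg _) h2.le k
  have hρk : ρ ^ k ≤ 1 := pow_le_one₀ hρ0.le hρ2.le
  have hρkp : 0 < ρ ^ k := by positivity
  have hq2k : ‖q m‖ ^ (2 * k) ≤ ρ ^ k := by
    rw [mul_comm, pow_mul, pow_two]
    nlinarith [pow_nonneg (norm_nonneg (q m)) k]
  have h1q : ‖1 - q m ^ 2‖ ≤ 2 := by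
    refine (norm_sub_le _ _).trans ?_
    rw [norm_pow, norm_one]
    nlinarith [norm_nonneg (q m), h1.1]
  have hlow : ‖E‖ - B1 * ρ ^ k ≤ ‖E - E' * q m ^ (2 * k)‖ := by
    refine le_trans ?_ (norm_sub_norm_le _ _)
    rw [norm_mul E', norm_pow]
    have : ‖E'‖ * ‖q m‖ ^ (2 * k) ≤ B1 * ρ ^ k := by gcongr
    linarith
  rw [← hcl, norm_mul, norm_mul, norm_pow] at hlow
  have hup : ‖1 - q m ^ 2‖ * ‖z - C‖ * ‖q m‖ ^ k ≤ 2 * (‖z‖ + B2) * ρ ^ k := by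
    gcongr
    exact (norm_sub_le _ _).trans (by linarith)
  have := hN k hk
  nlinarith

lemma zSeq_analyticAt {a w : ℂ → ℂ} {m0 : ℂ} (ha : AnalyticAt ℂ a m0) (hw : AnalyticAt ℂ w m0)
    (k : ℕ) : AnalyticAt ℂ (fun m => zSeq (a m) (w m) k) m0 := by
  induction k using Nat.twoStepInduction with
  | zero => simp only [zSeq]; exact analyticAt_const
  | one => simp only [zSeq]; exact hw
  | more n ih1 ih2 =>
    simp only [zSeq]
    exact ((ha.fun_mul ih2).fun_sub analyticAt_const).fun_sub ih1

/-- General term of the alternating series. -/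
noncomputable def altTerm (a w : ℂ) (k : ℕ) : ℂ := (-1) ^ k / (zSeq a w k * zSeq a w (k + 1))

lemma altTerm_meromorphicAt {a w : ℂ → ℂ} {m0 : ℂ} (ha : AnalyticAt ℂ a m0)
    (hw : AnalyticAt ℂ w m0) (k : ℕ) : MeromorphicAt (fun m => altTerm (a m) (w m) k) m0 := by
  unfold altTerm
  exact (MeromorphicAt.const _ _).fun_div
    ((zSeq_analyticAt ha hw k).meromorphicAt.fun_mul (zSeq_analyticAt ha hw (k + 1)).meromorphicAt)

/-- The alternating series is a finite sum plus a locally analytic tail. -/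
lemma altSum_split {a w : ℂ → ℂ} {m0 : ℂ}
    (ha : ∀ᶠ m in 𝓝 m0, AnalyticAt ℂ a m) (hw : ∀ᶠ m in 𝓝 m0, AnalyticAt ℂ w m)
    (hk : w m0 ^ 2 + w m0 + 2 = a m0 * w m0)
    (hq : ∀ᶠ m in 𝓝 m0, ∃ q : ℂ, ‖q‖ < 1 ∧ a m * q = q ^ 2 + 1)
    (ha2 : a m0 - 2 ≠ 0) :
    ∃ N0 : ℕ, (∀ k, N0 ≤ k → zSeq (a m0) (w m0) k ≠ 0) ∧
      ∀ N, N0 ≤ N → ∃ T : ℂ → ℂ, AnalyticAt ℂ T m0 ∧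
        ∀ᶠ m in 𝓝 m0, ∑' k, altTerm (a m) (w m) k =
          ∑ k ∈ Finset.range N, altTerm (a m) (w m) k + T m := by
  obtain ⟨ρ, c, N0, hρ0, hρ1, hc, hev⟩ := zSeq_growth ha.self_of_nhds.continuousAt
    hw.self_of_nhds.continuousAt hk hq ha2
  refine ⟨N0, ?_, ?_⟩
  · intro k hk h0
    have := hev.self_of_nhds k hk
    rw [h0] at this; simp at this; linarith
  intro N hN
  refine ⟨fun m => ∑' k, altTerm (a m) (w m) (k + N), ?_, ?_⟩
  all_goals
    obtain ⟨U, hU, hUo, hmU⟩ := mem_nhds_iff.1 (hev.and (ha.and hw))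
    have hne : ∀ m ∈ U, ∀ k, N ≤ k → zSeq (a m) (w m) k ≠ 0 := by
      intro m hm k hk h0
      have := (hU hm).1 k (hN.trans hk)
      rw [h0] at this; simp at this; linarith
    have hb : ∀ k m, m ∈ U → ‖altTerm (a m) (w m) (k + N)‖ ≤ (c⁻¹ ^ 2) * (ρ ^ k) := by
      intro k m hm
      have h1 := (hU hm).1 (k + N) (by omega)
      have h2 := (hU hm).1 (k + N + 1) (by omega)
      have hz : 0 < ‖zSeq (a m) (w m) (k + N)‖ := norm_pos_iff.2 (hne m hm _ (by omega))
      have hz' : 0 < ‖zSeq (a m) (w m) (k + N + 1)‖ := norm_pos_iff.2 (hne m hm _ (by omega))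
      unfold altTerm
      rw [norm_div, norm_pow, norm_neg, norm_one, one_pow, norm_mul]
      have hk1 : ρ ^ (k + N) ≤ ρ ^ k := pow_le_pow_of_le_one hρ0.le hρ1.le (by omega)
      have hk2 : ρ ^ (k + N + 1) ≤ 1 := pow_le_one₀ hρ0.le hρ1.le
      have hkp : 0 < ρ ^ k := by positivity
      rw [div_le_iff₀ (by positivity)]
      have h3 : c ≤ ‖zSeq (a m) (w m) (k + N)‖ * ρ ^ k := h1.trans (by gcongr)
      have h4 : c ≤ ‖zSeq (a m) (w m) (k + N + 1)‖ := by nlinarith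
      have h5 : c * c ≤ (‖zSeq (a m) (w m) (k + N)‖ * ρ ^ k) * ‖zSeq (a m) (w m) (k + N + 1)‖ := by
        gcongr
      have h6 : c⁻¹ ^ 2 * (c * c) = 1 := by field_simp
      have h7 : 0 < c⁻¹ ^ 2 := by positivity
      nlinarith
    have hs : Summable (fun k : ℕ => (c⁻¹ ^ 2) * (ρ ^ k)) :=
      (summable_geometric_of_lt_one hρ0.le hρ1).mul_left _
  · have hd : DifferentiableOn ℂ (fun m => ∑' k, altTerm (a m) (w m) (k + N)) U := by
      refine Complex.differentiableOn_tsum_of_summable_norm hs ?_ hUo (fun k m hm => hb k m hm)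
      intro k m hm
      apply DifferentiableAt.differentiableWithinAt
      unfold altTerm
      have hA := (hU hm).2
      exact (differentiableAt_const _).fun_div
        ((zSeq_analyticAt hA.1 hA.2 _).differentiableAt.fun_mul
          (zSeq_analyticAt hA.1 hA.2 _).differentiableAt)
        (mul_ne_zero (hne m hm _ (by omega)) (hne m hm _ (by omega)))
    exact hd.analyticAt (hUo.mem_nhds hmU)
  · filter_upwards [hUo.mem_nhds hmU] with m hm
    have : Summable (fun k => altTerm (a m) (w m) (k + N)) :=
      Summable.of_norm_bounded hs (fun k => hb k m hm)
    exact (((summable_nat_add_iff N).1 this).sum_add_tsum_nat_add N).symm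

/-- The analytic continuation of `T_0`. -/
noncomputable def altSum (a w : ℂ) : ℂ := ∑' k, altTerm a w k

lemma altSum_meromorphicAt {a w : ℂ → ℂ} {m0 : ℂ}
    (ha : ∀ᶠ m in 𝓝 m0, AnalyticAt ℂ a m) (hw : ∀ᶠ m in 𝓝 m0, AnalyticAt ℂ w m)
    (hk : w m0 ^ 2 + w m0 + 2 = a m0 * w m0)
    (hq : ∀ᶠ m in 𝓝 m0, ∃ q : ℂ, ‖q‖ < 1 ∧ a m * q = q ^ 2 + 1)
    (ha2 : a m0 - 2 ≠ 0) : MeromorphicAt (fun m => altSum (a m) (w m)) m0 := by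
  obtain ⟨N, -, h⟩ := altSum_split ha hw hk hq ha2
  obtain ⟨T, hT, hev⟩ := h N le_rfl
  have h1 : MeromorphicAt (fun m => ∑ k ∈ Finset.range N, altTerm (a m) (w m) k + T m) m0 :=
    (MeromorphicAt.fun_sum (fun k _ =>
      altTerm_meromorphicAt ha.self_of_nhds hw.self_of_nhds k)).fun_add hT.meromorphicAt
  refine h1.congr ?_
  exact (hev.filter_mono nhdsWithin_le_nhds).mono fun m hm => hm.symm

lemma altSum_pole {a w g : ℂ → ℂ} {m0 : ℂ}
    (ha : ∀ᶠ m in 𝓝 m0, AnalyticAt ℂ a m) (hw : ∀ᶠ m in 𝓝 m0, AnalyticAt ℂ w m)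
    (hk : w m0 ^ 2 + w m0 + 2 = a m0 * w m0)
    (hq : ∀ᶠ m in 𝓝 m0, ∃ q : ℂ, ‖q‖ < 1 ∧ a m * q = q ^ 2 + 1)
    (ha2 : a m0 - 2 ≠ 0) {n : ℕ}
    (hn : zSeq (a m0) (w m0) n = 0) (hn1 : zSeq (a m0) (w m0) (n + 1) = 0)
    (hoth : ∀ k, k ≠ n → k ≠ n + 1 → zSeq (a m0) (w m0) k ≠ 0)
    (hev1 : ∀ᶠ m in 𝓝[≠] m0, zSeq (a m) (w m) n ≠ 0)
    (hev2 : ∀ᶠ m in 𝓝[≠] m0, zSeq (a m) (w m) (n + 1) ≠ 0)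
    (hg : AnalyticAt ℂ g m0) (hg0 : g m0 ≠ 0) :
    meromorphicOrderAt (fun m => (1 - 2 * altSum (a m) (w m)) * g m) m0 < 0 := by
  have haa := ha.self_of_nhds
  have hww := hw.self_of_nhds
  set Z : ℕ → ℂ → ℂ := fun k m => zSeq (a m) (w m) k with hZ
  have hZt : ∀ k, Tendsto (Z k) (𝓝[≠] m0) (𝓝 (Z k m0)) := fun k =>
    (zSeq_analyticAt haa hww k).continuousAt.tendsto.mono_left nhdsWithin_le_nhds
  have hgt : Tendsto g (𝓝[≠] m0) (𝓝 (g m0)) :=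
    hg.continuousAt.tendsto.mono_left nhdsWithin_le_nhds
  obtain ⟨N0, -, h⟩ := altSum_split ha hw hk hq ha2
  obtain ⟨T, hT, hev⟩ := h (max N0 (n + 1)) (le_max_left _ _)
  set N := max N0 (n + 1)
  have hnN : n < N := lt_of_lt_of_le (Nat.lt_succ_self n) (le_max_right _ _)
  have hZn : Tendsto (Z n) (𝓝[≠] m0) (𝓝 0) := by simpa [hZ, hn] using hZt n
  have hZn1 : Tendsto (Z (n + 1)) (𝓝[≠] m0) (𝓝 0) := by simpa [hZ, hn1] using hZt (n + 1)
  have hterm : ∀ k, Tendsto (fun m => Z n m * Z (n + 1) m * altTerm (a m) (w m) k) (𝓝[≠] m0)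
      (𝓝 (if k = n then (-1) ^ n else 0)) := by
    intro k
    by_cases hkn : k = n
    · rw [if_pos hkn, hkn]
      refine tendsto_const_nhds.congr' ?_
      filter_upwards [hev1, hev2] with m h1 h2
      simp only [hZ, altTerm]
      field_simp
    rw [if_neg hkn]
    by_cases hk1 : k = n + 1
    · subst hk1
      have h2 : Z (n + 2) m0 ≠ 0 := hoth _ (by omega) (by omega)
      have h3 : Tendsto (fun m => (-1) ^ (n + 1) * (Z n m / Z (n + 2) m)) (𝓝[≠] m0) (𝓝 0) := by
        simpa using (hZn.div (hZt (n + 2)) h2).const_mul ((-1 : ℂ) ^ (n + 1))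
      refine h3.congr' ?_
      filter_upwards [hev2, (hZt (n + 2)).eventually_ne h2] with m h4 h5
      simp only [hZ, altTerm] at h5 ⊢
      field_simp
    by_cases hk2 : k + 1 = n
    · subst hk2
      have h2 : Z k m0 ≠ 0 := hoth _ (by omega) (by omega)
      have h3 : Tendsto (fun m => (-1) ^ k * (Z (k + 2) m / Z k m)) (𝓝[≠] m0) (𝓝 0) := by
        simpa using (hZn1.div (hZt k) h2).const_mul ((-1 : ℂ) ^ k)
      refine h3.congr' ?_
      filter_upwards [hev1, (hZt k).eventually_ne h2] with m h4 h5
      simp only [hZ, altTerm] at h5 ⊢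
      field_simp
    · have h2 : Z k m0 ≠ 0 := hoth _ (by omega) (by omega)
      have h3 : Z (k + 1) m0 ≠ 0 := hoth _ (by omega) (by omega)
      have := (hZn.mul hZn1).mul
        ((tendsto_const_nhds (x := (-1 : ℂ) ^ k)).div ((hZt k).mul (hZt (k + 1)))
          (mul_ne_zero h2 h3))
      simpa [altTerm] using this
  have hTt : Tendsto T (𝓝[≠] m0) (𝓝 (T m0)) :=
    hT.continuousAt.tendsto.mono_left nhdsWithin_le_nhds
  have hmain : Tendsto (fun m => Z n m * Z (n + 1) m * ((1 - 2 * altSum (a m) (w m)) * g m))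
      (𝓝[≠] m0) (𝓝 (-2 * (-1) ^ n * g m0)) := by
    have h1 := tendsto_finsetSum (Finset.range N) (fun k _ => hterm k)
    have h2 := (((hZn.mul hZn1).mul (hTt.const_mul (-2) |>.add_const 1)).add
      (h1.const_mul (-2))).mul hgt
    rw [Finset.sum_ite_eq' , if_pos (Finset.mem_range.2 hnN)] at h2
    simp only [mul_zero, zero_mul, zero_add] at h2
    refine h2.congr' ?_
    filter_upwards [hev.filter_mono nhdsWithin_le_nhds] with m hm
    rw [altSum, hm, ← Finset.mul_sum]
    ring
  have hmer : MeromorphicAt (fun m => (1 - 2 * altSum (a m) (w m)) * g m) m0 :=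
    ((MeromorphicAt.const 1 _).fun_sub ((MeromorphicAt.const 2 _).fun_mul
      (altSum_meromorphicAt ha hw hk hq ha2))).fun_mul hg.meromorphicAt
  by_contra hlt
  obtain ⟨L, hL⟩ := (tendsto_nhds_iff_meromorphicOrderAt_nonneg hmer).2 (not_lt.1 hlt)
  have h0 := (hZn.mul hZn1).mul hL
  have := tendsto_nhds_unique hmain h0
  simp [hg0] at this

open Filter Topology

lemma zSeq_base_growth {a w : ℂ} (ha : 5 ≤ ‖a‖) (hw : 3 ≤ ‖w‖) (k : ℕ) :
    (3 : ℝ) ^ k ≤ ‖zSeq a w k‖ ∧ 3 * ‖zSeq a w k‖ ≤ ‖zSeq a w (k + 1)‖ := by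
  induction k with
  | zero => simp [zSeq, hw]
  | succ k ih =>
    obtain ⟨h1, h2⟩ := ih
    have h0 : (1 : ℝ) ≤ 3 ^ k := one_le_pow₀ (by norm_num)
    refine ⟨by rw [pow_succ]; linarith, ?_⟩
    have e : zSeq a w (k + 1 + 1) = a * zSeq a w (k + 1) - 1 - zSeq a w k := rfl
    rw [e]
    have h3 := norm_sub_norm_le (a * zSeq a w (k + 1) - 1) (zSeq a w k)
    have h4 := norm_sub_norm_le (a * zSeq a w (k + 1)) 1
    rw [norm_mul, norm_one] at h4
    nlinarith [norm_nonneg (zSeq a w k)]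

lemma base_identity {t a w : ℂ} (hta : t * a = 1) (ha : 5 ≤ ‖a‖) (hw : 3 ≤ ‖w‖)
    (hk : w ^ 2 + w + 2 = a * w) :
    (1 - 4 * t) * evPS (walkGF stepB) t = 1 - 2 * altSum a w := by
  have ht : ‖t‖ < 1 / 4 := by
    have := congrArg norm hta
    rw [norm_mul, norm_one] at this
    nlinarith [norm_nonneg t]
  set Z := zSeq a w with hZ
  have hg := zSeq_base_growth ha hw
  have hZ1 : ∀ k, (1 : ℝ) ≤ ‖Z k‖ := fun k =>
    (one_le_pow₀ (by norm_num : (1 : ℝ) ≤ 3)).trans (hg k).1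
  have hZ0 : ∀ k, Z k ≠ 0 := fun k h => by
    have := hZ1 k; rw [h, norm_zero] at this; linarith
  set Y : ℕ → ℂ := fun k => (Z k)⁻¹ with hY
  have hY3 : ∀ k, ‖Y k‖ ≤ (1 / 3) ^ k := fun k => by
    simp only [hY]; rw [norm_inv, one_div, inv_pow]
    exact inv_anti₀ (by positivity) (hg k).1
  have hY1 : ∀ k, ‖Y k‖ ≤ 1 := fun k =>
    (hY3 k).trans (pow_le_one₀ (by norm_num) (by norm_num))
  set T : ℕ → ℂ := fun k => t * Y k ^ 2 * (bigQ t 0 (Y k) + bigQ t (Y k) 0) with hT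
  have hker : ∀ k, t * (Y (k + 1) ^ 2 + Y k * Y (k + 1) ^ 2 + Y k ^ 2 * Y (k + 1) + Y k ^ 2)
      = Y k * Y (k + 1) := by
    intro k
    have h := zSeq_kernel hk k
    have hz := hZ0 k
    have hz1 := hZ0 (k + 1)
    simp only [hY]
    rw [← hZ] at h
    field_simp
    linear_combination t * h + Z k * Z (k + 1) * hta
  have hTT : ∀ k, T k + T (k + 1) = 2 * (Y k * Y (k + 1)) := by
    intro k
    have h1 := bigQ_kernel ht (hY1 k) (hY1 (k + 1)) (hker k)
    have h2 := bigQ_kernel ht (hY1 (k + 1)) (hY1 k)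
      (by linear_combination hker k)
    simp only [hT]
    linear_combination h1 + h2
  have halt : ∀ k, altTerm a w k = (-1) ^ k * (Y k * Y (k + 1)) := by
    intro k
    simp only [altTerm, hY, ← hZ, div_eq_mul_inv, mul_inv]
  have hpart : ∀ N, 2 * ∑ k ∈ Finset.range N, altTerm a w k = T 0 - (-1) ^ N * T N := by
    intro N
    induction N with
    | zero => simp
    | succ N ih =>
      rw [Finset.sum_range_succ, mul_add, ih, halt, pow_succ]
      linear_combination -(-1) ^ N * hTT N
  have hsum : Summable (fun k => altTerm a w k) := by
    refine Summable.of_norm_bounded (summable_geometric_of_lt_one (r := 1 / 3)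
      (by norm_num) (by norm_num)) (fun k => ?_)
    rw [halt, norm_mul, norm_mul, norm_pow, norm_neg, norm_one, one_pow, one_mul]
    calc ‖Y k‖ * ‖Y (k + 1)‖ ≤ (1 / 3) ^ k * 1 := by
          gcongr
          · exact hY3 k
          · exact hY1 _
      _ = _ := mul_one _
  have hTlim : Tendsto (fun N => (-1) ^ N * T N) atTop (𝓝 0) := by
    have hb : Tendsto (fun N : ℕ => (1 / 3 : ℝ) ^ N * (2 * (1 - 4 * ‖t‖)⁻¹)) atTop (𝓝 0) := by
      simpa using (tendsto_pow_atTop_nhds_zero_of_lt_one (r := (1 / 3 : ℝ)) (by norm_num)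
        (by norm_num)).mul_const (2 * (1 - 4 * ‖t‖)⁻¹)
    refine squeeze_zero_norm (fun N => ?_) hb
    rw [norm_mul, norm_pow, norm_neg, norm_one, one_pow, one_mul]
    simp only [hT]
    rw [norm_mul, norm_mul, norm_pow]
    have b1 := bigQ_bound ht (x := 0) (by simp) (hY1 N)
    have b2 := bigQ_bound ht (y := 0) (hY1 N) (by simp)
    have b3 := norm_add_le (bigQ t 0 (Y N)) (bigQ t (Y N) 0)
    have b4 : ‖t‖ * ‖Y N‖ ^ 2 ≤ (1 / 3) ^ N := by
      have := hY3 N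
      have := hY1 N
      have := norm_nonneg (Y N)
      have h5 : ‖t‖ ≤ 1 := by linarith
      calc ‖t‖ * ‖Y N‖ ^ 2 ≤ 1 * (‖Y N‖ * 1) := by
            rw [pow_two]; gcongr
        _ ≤ _ := by linarith
    have : 0 ≤ ‖t‖ * ‖Y N‖ ^ 2 := by positivity
    exact mul_le_mul b4 (by linarith) (norm_nonneg _) (by positivity)
  have h1 : Tendsto (fun N => 2 * ∑ k ∈ Finset.range N, altTerm a w k) atTop
      (𝓝 (2 * altSum a w)) := hsum.hasSum.tendsto_sum_nat.const_mul 2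
  have h2 : Tendsto (fun N => 2 * ∑ k ∈ Finset.range N, altTerm a w k) atTop (𝓝 (T 0)) := by
    simp only [hpart]
    simpa using hTlim.const_sub (T 0)
  have h3 := tendsto_nhds_unique h1 h2
  rw [h3, ← bigQ_one]
  have h4 := bigQ_functional ht (x := 1) (y := 1) (by simp) (by simp)
  have hY0 : Y 0 = 1 := by simp [hY, hZ, zSeq]
  simp only [hT, hY0]
  linear_combination h4

open Filter Topology

/-- The real number `√2` as a complex number. -/
noncomputable def kap : ℂ := ((Real.sqrt 2 : ℝ) : ℂ)

lemma kap_sq : kap ^ 2 = 2 := by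
  unfold kap
  rw [← Complex.ofReal_pow, Real.sq_sqrt (by norm_num)]; norm_num

lemma kap_ne : kap ≠ 0 := by
  intro h; have := kap_sq; rw [h] at this; norm_num at this

lemma sqrt2_gt : (1.4 : ℝ) < Real.sqrt 2 := by
  apply Real.lt_sqrt_of_sq_lt; norm_num

/-- Parametrized `w`. -/
noncomputable def wM (m : ℂ) : ℂ := kap * (1 + m) / (1 - m)
/-- Parametrized `a`. -/
noncomputable def aM (m : ℂ) : ℂ := 1 + 2 * kap * (1 + m ^ 2) / (1 - m ^ 2)
/-- Parametrized `t`. -/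
noncomputable def tM (m : ℂ) : ℂ := (1 - m ^ 2) / ((1 + 2 * kap) + (2 * kap - 1) * m ^ 2)

/-- The parameter domain. -/
def OmM : Set ℂ :=
  {m | (m ^ 2).im ≠ 0 ∨ ((1 - 2 * Real.sqrt 2) < (1 + 2 * Real.sqrt 2) * (m ^ 2).re ∧
    (m ^ 2).re < 1)}

lemma OmM_isOpen : IsOpen OmM := by
  have h1 : Continuous fun m : ℂ => (m ^ 2).im := by fun_prop
  have h2 : Continuous fun m : ℂ => (m ^ 2).re := by fun_prop
  refine IsOpen.union (isOpen_ne_fun h1 continuous_const) (IsOpen.inter ?_ ?_)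
  · exact isOpen_lt continuous_const (continuous_const.mul h2)
  · exact isOpen_lt h2 continuous_const

lemma OmM_preconnected : IsPreconnected OmM := by
  have hs := sqrt2_gt
  have h0 : (0 : ℂ) ∈ OmM := by
    right; simp; linarith
  have : StarConvex ℝ 0 OmM := by
    rw [starConvex_zero_iff]
    intro m hm s hs0 hs1
    rcases eq_or_lt_of_le hs0 with h | h
    · rw [← h, zero_smul]; exact h0
    have e : (s • m) ^ 2 = ((s ^ 2 : ℝ) : ℂ) * m ^ 2 := by
      rw [Complex.real_smul]; push_cast; ring
    have hre : ((s • m) ^ 2).re = s ^ 2 * (m ^ 2).re := by rw [e, Complex.re_ofReal_mul]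
    have him : ((s • m) ^ 2).im = s ^ 2 * (m ^ 2).im := by rw [e, Complex.im_ofReal_mul]
    have hsp : 0 < s ^ 2 := by positivity
    have hs2 : s ^ 2 ≤ 1 := pow_le_one₀ hs0 hs1
    unfold OmM at hm ⊢
    rw [Set.mem_ofPred_eq, hre, him]
    rcases hm with hm | ⟨hm1, hm2⟩
    · left; exact mul_ne_zero hsp.ne' hm
    · right
      constructor
      · nlinarith
      · nlinarith
  exact (this.isPathConnected h0).isConnected.isPreconnected

lemma OmM_sq_ne {m : ℂ} (hm : m ∈ OmM) : 1 - m ^ 2 ≠ 0 := by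
  intro h
  have h' : m ^ 2 = 1 := by linear_combination -h
  rcases hm with hm | hm <;> rw [h'] at hm <;> simp at hm

lemma OmM_one_sub {m : ℂ} (hm : m ∈ OmM) : 1 - m ≠ 0 := by
  intro h; apply OmM_sq_ne hm; linear_combination (1 + m) * h

lemma OmM_one_add {m : ℂ} (hm : m ∈ OmM) : 1 + m ≠ 0 := by
  intro h; apply OmM_sq_ne hm; linear_combination (1 - m) * h

lemma OmM_den {m : ℂ} (hm : m ∈ OmM) : (1 + 2 * kap) + (2 * kap - 1) * m ^ 2 ≠ 0 := by
  intro h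
  have hs := sqrt2_gt
  have hre := congrArg Complex.re h
  have him := congrArg Complex.im h
  have e : (1 + 2 * kap) + (2 * kap - 1) * m ^ 2 =
      ((1 + 2 * Real.sqrt 2 : ℝ) : ℂ) + ((2 * Real.sqrt 2 - 1 : ℝ) : ℂ) * m ^ 2 := by
    unfold kap; push_cast; ring
  rw [e, Complex.add_re, Complex.re_ofReal_mul, Complex.ofReal_re, Complex.zero_re] at hre
  rw [e, Complex.add_im, Complex.im_ofReal_mul, Complex.ofReal_im, Complex.zero_im, zero_add] at him
  have h3 : (m ^ 2).im = 0 := by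
    rcases mul_eq_zero.1 him with h | h
    · linarith
    · exact h
  rcases hm with hm | hm
  · exact hm h3
  · nlinarith [hm.1]

lemma kernel_M {m : ℂ} (hm : m ∈ OmM) : wM m ^ 2 + wM m + 2 = aM m * wM m := by
  have h1 := OmM_one_sub hm
  have h2 := OmM_sq_ne hm
  have h3 := OmM_one_add hm
  have e : (1 - m ^ 2) = (1 - m) * (1 + m) := by ring
  unfold wM aM
  rw [e]
  field_simp
  linear_combination -(1 - m) ^ 2 * kap_sq

lemma tM_aM {m : ℂ} (hm : m ∈ OmM) : tM m * aM m = 1 := by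
  have h2 := OmM_sq_ne hm
  have h3 := OmM_den hm
  have e : aM m = ((1 + 2 * kap) + (2 * kap - 1) * m ^ 2) / (1 - m ^ 2) := by
    unfold aM; field_simp; ring
  rw [e, tM, div_mul_div_cancel₀ h3, div_self h2]

lemma aM_real {m : ℂ} (hm : m ∈ OmM) {x : ℝ} (hx : aM m = x) : 2 < x := by
  have hs := sqrt2_gt
  have h2 := OmM_sq_ne hm
  have e : ((x - 1 + 2 * Real.sqrt 2 : ℝ) : ℂ) * m ^ 2 = ((x - 1 - 2 * Real.sqrt 2 : ℝ) : ℂ) := by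
    unfold aM at hx
    field_simp at hx
    unfold kap at hx
    push_cast
    linear_combination hx
  have hre := congrArg Complex.re e
  have him := congrArg Complex.im e
  rw [Complex.re_ofReal_mul, Complex.ofReal_re] at hre
  rw [Complex.im_ofReal_mul, Complex.ofReal_im] at him
  rcases mul_eq_zero.1 him with h | h
  · rw [h] at hre; linarith
  rcases hm with hm | hm
  · exact absurd h hm
  obtain ⟨h3, h4⟩ := hm
  by_contra hx2
  push Not at hx2
  nlinarith

lemma exists_q {a : ℂ} (h : ∀ x : ℝ, a = x → 2 < x) :
    ∃ q : ℂ, ‖q‖ < 1 ∧ a * q = q ^ 2 + 1 := by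
  obtain ⟨s, hs⟩ := IsAlgClosed.exists_pow_nat_eq (a ^ 2 - 4) (n := 2) (by norm_num)
  set q := (a + s) / 2 with hq
  have hq1 : a * q = q ^ 2 + 1 := by rw [hq]; linear_combination -hs / 4
  have hpr : q * (a - q) = 1 := by linear_combination hq1
  have hn : ‖q‖ * ‖a - q‖ = 1 := by rw [← norm_mul, hpr, norm_one]
  rcases lt_trichotomy ‖q‖ 1 with h1 | h1 | h1
  · exact ⟨q, h1, hq1⟩
  · exfalso
    have h2 : q * (starRingEnd ℂ) q = 1 := by
      rw [Complex.mul_conj, Complex.normSq_eq_norm_sq, h1]; norm_num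
    have hq0 : q ≠ 0 := by intro h0; rw [h0] at h1; simp at h1
    have h3 : a - q = (starRingEnd ℂ) q := by
      apply mul_left_cancel₀ hq0; rw [hpr, h2]
    have h4 : a = ((2 * q.re : ℝ) : ℂ) := by
      rw [← Complex.add_conj, ← h3]; ring
    have h5 := h _ h4
    have := (Complex.re_le_norm q)
    linarith
  · refine ⟨a - q, ?_, by linear_combination hq1⟩
    by_contra h2
    push Not at h2
    nlinarith

lemma aM_ne_two {m : ℂ} (hm : m ∈ OmM) : aM m - 2 ≠ 0 := by
  intro h
  have := aM_real hm (x := 2) (by push_cast; linear_combination h)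
  linarith

lemma aM_analytic {m : ℂ} (hm : m ∈ OmM) : AnalyticAt ℂ aM m := by
  have := OmM_sq_ne hm
  unfold aM
  fun_prop (disch := assumption)

lemma wM_analytic {m : ℂ} (hm : m ∈ OmM) : AnalyticAt ℂ wM m := by
  have := OmM_one_sub hm
  unfold wM
  fun_prop (disch := assumption)

lemma tM_analytic {m : ℂ} (hm : m ∈ OmM) : AnalyticAt ℂ tM m := by
  have := OmM_den hm
  unfold tM
  fun_prop (disch := assumption)

lemma tM_deriv {m : ℂ} (hm : m ∈ OmM) (h0 : m ≠ 0) : deriv tM m ≠ 0 := by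
  have hd := OmM_den hm
  have h1 : HasDerivAt (fun m : ℂ => 1 - m ^ 2) (-(2 * m)) m := by
    simpa using (hasDerivAt_pow 2 m).const_sub 1
  have h2 : HasDerivAt (fun m : ℂ => (1 + 2 * kap) + (2 * kap - 1) * m ^ 2)
      ((2 * kap - 1) * (2 * m)) m := by
    simpa using ((hasDerivAt_pow 2 m).const_mul (2 * kap - 1)).const_add (1 + 2 * kap)
  have h3 := h1.div h2 hd
  have h4 : deriv tM m = _ := h3.deriv
  rw [h4]
  refine div_ne_zero ?_ (pow_ne_zero _ hd)
  have : -(2 * m) * ((1 + 2 * kap) + (2 * kap - 1) * m ^ 2) - (1 - m ^ 2) * ((2 * kap - 1) * (2 * m))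
      = -8 * kap * m := by ring
  rw [this]
  exact mul_ne_zero (mul_ne_zero (by norm_num) kap_ne) h0

lemma m_of_w {a w : ℂ} (h : ∀ x : ℝ, a = x → 2 < x) (hk : w ^ 2 + w + 2 = a * w) :
    ∃ m ∈ OmM, aM m = a ∧ wM m = w := by
  have hs := sqrt2_gt
  have hk0 := kap_ne
  have hk2 := kap_sq
  have hw0 : w ≠ 0 := by rintro rfl; norm_num at hk
  have hw1 : w + kap ≠ 0 := by
    intro h1
    have h2 : w = -kap := by linear_combination h1
    have h3 : a = ((1 - 2 * Real.sqrt 2 : ℝ) : ℂ) := by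
      rw [h2] at hk
      apply mul_left_cancel₀ hk0
      push_cast
      show kap * a = kap * (1 - 2 * kap)
      linear_combination hk + kap_sq
    have := h _ h3
    linarith
  set m := (w - kap) / (w + kap) with hm
  have e1 : 1 - m = 2 * kap / (w + kap) := by rw [hm]; field_simp; ring
  have e2 : 1 + m = 2 * w / (w + kap) := by rw [hm]; field_simp; ring
  have n1 : 1 - m ≠ 0 := by
    rw [e1]; exact div_ne_zero (mul_ne_zero two_ne_zero hk0) hw1
  have n2 : 1 + m ≠ 0 := by
    rw [e2]; exact div_ne_zero (mul_ne_zero two_ne_zero hw0) hw1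
  have n3 : 1 - m ^ 2 ≠ 0 := by
    have : 1 - m ^ 2 = (1 - m) * (1 + m) := by ring
    rw [this]; exact mul_ne_zero n1 n2
  have hwm : wM m = w := by
    unfold wM; rw [e1, e2]; field_simp
  have ham : aM m = a := by
    apply mul_right_cancel₀ hw0
    rw [← hk]
    unfold aM
    have e3 : (1 - m ^ 2) = 4 * kap * w / (w + kap) ^ 2 := by
      have : 1 - m ^ 2 = (1 - m) * (1 + m) := by ring
      rw [this, e1, e2]; field_simp; ring
    have e4 : (1 + m ^ 2) = 2 * (w ^ 2 + 2) / (w + kap) ^ 2 := by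
      rw [hm]; field_simp; linear_combination 2 * kap_sq
    rw [e3, e4]
    field_simp
    ring
  refine ⟨m, ?_, ham, hwm⟩
  by_contra hcon
  unfold OmM at hcon
  rw [Set.mem_ofPred_eq] at hcon
  push Not at hcon
  obtain ⟨him, hre⟩ := hcon
  set r := (m ^ 2).re with hr
  have hmr : m ^ 2 = (r : ℂ) := by
    apply Complex.ext
    · simp [hr]
    · rw [him]; simp
  have hr1 : 1 - r ≠ 0 := by
    intro h1; apply n3; rw [hmr]; exact_mod_cast h1
  have h5 : a = ((1 + 2 * Real.sqrt 2 * (1 + r) / (1 - r) : ℝ) : ℂ) := by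
    rw [← ham]; unfold aM; rw [hmr]; unfold kap; push_cast; ring
  have h6 := h _ h5
  rcases lt_or_gt_of_ne hr1 with h7 | h7
  · have : 2 * Real.sqrt 2 * (1 + r) / (1 - r) < 0 := by
      apply div_neg_of_pos_of_neg _ h7
      have : 0 < 1 + r := by linarith
      positivity
    linarith
  · have h8 : 1 < 2 * Real.sqrt 2 * (1 + r) / (1 - r) := by linarith
    rw [lt_div_iff₀ h7] at h8
    have := hre (by linarith)
    linarith

lemma pole_a_real {q : ℂ} (hq0 : q ≠ 0) (hq1 : ‖q‖ < 1)
    (hneg : ∀ s : ℝ, 0 < s → q ≠ ((-s : ℝ) : ℂ)) (x : ℝ) (hx : q + 1 / q = x) : 2 < x := by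
  have h1 : (x : ℂ) * q = q ^ 2 + 1 := by rw [← hx]; field_simp
  have hre := congrArg Complex.re h1
  have him := congrArg Complex.im h1
  simp [pow_two] at hre him
  have hn : q.re * q.re + q.im * q.im < 1 := by
    have := Complex.normSq_apply q
    rw [← this, Complex.normSq_eq_norm_sq]
    nlinarith [norm_nonneg q]
  by_cases h0 : q.im = 0
  · have hqr : q = (q.re : ℂ) := by apply Complex.ext <;> simp [h0]
    have hp : 0 < q.re := by
      rcases lt_trichotomy q.re 0 with h | h | h
      · exfalso; apply hneg (-q.re) (by linarith); rw [neg_neg]; exact hqr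
      · exfalso; apply hq0; rw [hqr, h]; simp
      · exact h
    rw [h0] at hre hn
    have hlt : q.re < 1 := by nlinarith
    by_contra hx2
    push Not at hx2
    have h5 := mul_le_mul_of_nonneg_right hx2 hp.le
    have h6 : 0 < (1 - q.re) ^ 2 := pow_pos (by linarith) 2
    nlinarith
  · exfalso
    have : x = 2 * q.re := by
      apply mul_right_cancel₀ h0; linarith
    rw [this] at hre
    nlinarith

/-- The poles. -/
lemma exists_pole_M (n : ℕ) (hn : 5 ≤ n) (hodd : Odd n) :
    ∃ m ∈ OmM, zSeq (aM m) (wM m) n = 0 ∧ zSeq (aM m) (wM m) (n + 1) = 0 ∧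
      ∀ k, k ≠ n → k ≠ n + 1 → zSeq (aM m) (wM m) k ≠ 0 := by
  obtain ⟨q, hq0, hq1, hneg, hS⟩ := exists_pole_param n hn hodd
  have h1 : (q + 1 / q) * q = q ^ 2 + 1 := by field_simp
  obtain ⟨hk, hz, hz1, hoth⟩ := pole_structure hS rfl h1 hq1
  obtain ⟨m, hm, ha, hw⟩ := m_of_w (pole_a_real hq0 hq1 hneg) hk
  refine ⟨m, hm, ?_⟩
  rw [ha, hw]
  exact ⟨hz, hz1, hoth⟩

open Filter Topology

lemma half_mem : (1 / 2 : ℂ) ∈ OmM := by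
  have hs := sqrt2_gt
  have e : (1 / 2 : ℂ) ^ 2 = ((1 / 4 : ℝ) : ℂ) := by push_cast; norm_num
  right
  rw [e, Complex.ofReal_re]
  constructor
  · linarith
  · norm_num

lemma kap_norm : ‖kap‖ = Real.sqrt 2 := by
  unfold kap
  rw [Complex.norm_real, Real.norm_of_nonneg (Real.sqrt_nonneg _)]

lemma wM_half : 3 < ‖wM (1 / 2)‖ := by
  have e : wM (1 / 2) = 3 * kap := by unfold wM; ring
  rw [e, norm_mul, kap_norm]
  have := sqrt2_gt
  norm_num
  linarith

lemma aM_half : 5 < ‖aM (1 / 2)‖ := by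
  have hs := sqrt2_gt
  have e : aM (1 / 2) = ((1 + 10 / 3 * Real.sqrt 2 : ℝ) : ℂ) := by
    unfold aM kap; push_cast; ring
  rw [e, Complex.norm_real, Real.norm_of_nonneg (by positivity)]
  linarith

/-- The continued generating function. -/
noncomputable def FM (m : ℂ) : ℂ := (1 - 2 * altSum (aM m) (wM m)) * (1 - 4 * tM m)⁻¹

lemma OmM_ev {m : ℂ} (hm : m ∈ OmM) : ∀ᶠ x in 𝓝 m, x ∈ OmM := OmM_isOpen.mem_nhds hm

lemma ev_a {m : ℂ} (hm : m ∈ OmM) : ∀ᶠ x in 𝓝 m, AnalyticAt ℂ aM x :=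
  (OmM_ev hm).mono fun _ h => aM_analytic h

lemma ev_w {m : ℂ} (hm : m ∈ OmM) : ∀ᶠ x in 𝓝 m, AnalyticAt ℂ wM x :=
  (OmM_ev hm).mono fun _ h => wM_analytic h

lemma ev_q {m : ℂ} (hm : m ∈ OmM) :
    ∀ᶠ x in 𝓝 m, ∃ q : ℂ, ‖q‖ < 1 ∧ aM x * q = q ^ 2 + 1 :=
  (OmM_ev hm).mono fun _ h => exists_q fun _ hx => aM_real h hx

lemma FM_meromorphic {m : ℂ} (hm : m ∈ OmM) : MeromorphicAt FM m := by
  unfold FM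
  exact ((MeromorphicAt.const 1 _).fun_sub ((MeromorphicAt.const 2 _).fun_mul
    (altSum_meromorphicAt (ev_a hm) (ev_w hm) (kernel_M hm) (ev_q hm) (aM_ne_two hm)))).fun_mul
    ((MeromorphicAt.const 1 _).fun_sub ((MeromorphicAt.const 4 _).fun_mul
      (tM_analytic hm).meromorphicAt)).fun_inv

lemma tM_small {m : ℂ} (hm : m ∈ OmM) (ha : 5 < ‖aM m‖) : ‖tM m‖ < 1 / 4 := by
  have := congrArg norm (tM_aM hm)
  rw [norm_mul, norm_one] at this
  nlinarith [norm_nonneg (tM m)]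

lemma one_sub_ne {t : ℂ} (ht : ‖t‖ < 1 / 4) : 1 - 4 * t ≠ 0 := by
  intro h
  have h1 : t = 1 / 4 := by linear_combination -h / 4
  rw [h1] at ht
  norm_num at ht

lemma FM_base : FM =ᶠ[𝓝 (1 / 2)] fun m => evPS (walkGF stepB) (tM m) := by
  have ha := (aM_analytic half_mem).continuousAt.norm.eventually (lt_mem_nhds aM_half)
  have hw := (wM_analytic half_mem).continuousAt.norm.eventually (lt_mem_nhds wM_half)
  filter_upwards [ha, hw, OmM_ev half_mem] with m h1 h2 h3
  have h4 := base_identity (tM_aM h3) h1.le h2.le (kernel_M h3)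
  have h5 := one_sub_ne (tM_small h3 h1)
  unfold FM
  rw [← h4]
  field_simp

lemma zM_ev_ne {m : ℂ} (hm : m ∈ OmM) (n : ℕ) :
    ∀ᶠ x in 𝓝[≠] m, zSeq (aM x) (wM x) n ≠ 0 := by
  by_contra h
  have hf : ∃ᶠ x in 𝓝[≠] m, zSeq (aM x) (wM x) n = 0 := by
    rw [Filter.not_eventually] at h
    exact h.mono fun x hx => not_not.1 hx
  have han : AnalyticOnNhd ℂ (fun x => zSeq (aM x) (wM x) n) OmM := fun x hx =>
    zSeq_analyticAt (aM_analytic hx) (wM_analytic hx) n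
  have h0 := han.eqOn_zero_of_preconnected_of_frequently_eq_zero OmM_preconnected hm hf half_mem
  have h1 := (zSeq_base_growth aM_half.le wM_half.le n).1
  simp only [Pi.zero_apply] at h0
  rw [h0, norm_zero] at h1
  have : (0 : ℝ) < 3 ^ n := by positivity
  linarith

lemma FM_pole {m : ℂ} (hm : m ∈ OmM) (ht : 1 - 4 * tM m ≠ 0) {n : ℕ}
    (hn : zSeq (aM m) (wM m) n = 0) (hn1 : zSeq (aM m) (wM m) (n + 1) = 0)
    (hoth : ∀ k, k ≠ n → k ≠ n + 1 → zSeq (aM m) (wM m) k ≠ 0) :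
    meromorphicOrderAt FM m < 0 := by
  have hg : AnalyticAt ℂ (fun x => (1 - 4 * tM x)⁻¹) m :=
    (analyticAt_const.fun_sub (analyticAt_const.fun_mul (tM_analytic hm))).fun_inv ht
  exact altSum_pole (ev_a hm) (ev_w hm) (kernel_M hm) (ev_q hm) (aM_ne_two hm) hn hn1 hoth
    (zM_ev_ne hm n) (zM_ev_ne hm (n + 1)) hg (inv_ne_zero ht)

lemma tM_fiber_finite {S : Set ℂ} (hS : S.Finite) : {m | m ∈ OmM ∧ tM m ∈ S}.Finite := by
  set φ : ℂ → ℂ := fun t => (1 - (1 + 2 * kap) * t) / (1 + (2 * kap - 1) * t)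
  have h1 : ((fun m : ℂ => m ^ 2) ⁻¹' (Set.image φ S)).Finite := by
    refine Set.Finite.preimage' (hS.image φ) fun b _ => ?_
    refine (Polynomial.nthRoots 2 b).toFinset.finite_toSet.subset fun m hm => ?_
    simp only [Finset.mem_coe, Multiset.mem_toFinset]
    rw [Polynomial.mem_nthRoots (by norm_num)]
    exact hm
  refine h1.subset ?_
  rintro m ⟨hm, ht⟩
  refine ⟨tM m, ht, ?_⟩
  have hd := OmM_den hm
  have hk := kap_ne
  have e1 : 1 + (2 * kap - 1) * tM m = 4 * kap / ((1 + 2 * kap) + (2 * kap - 1) * m ^ 2) := by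
    rw [tM, eq_div_iff hd, add_mul, mul_assoc, div_mul_cancel₀ _ hd]; ring
  have e2 : 1 - (1 + 2 * kap) * tM m
      = 4 * kap * m ^ 2 / ((1 + 2 * kap) + (2 * kap - 1) * m ^ 2) := by
    rw [tM, eq_div_iff hd, sub_mul, mul_assoc, div_mul_cancel₀ _ hd]; ring
  simp only [φ]
  rw [e1, e2, div_div_div_cancel_right₀ hd, mul_div_cancel_left₀]
  exact mul_ne_zero (by norm_num) hk

/-- A pole avoiding a given polynomial. -/
lemma exists_good_pole {P : Polynomial ℂ} (hP : P ≠ 0) :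
    ∃ m ∈ OmM, m ≠ 0 ∧ P.eval (tM m) ≠ 0 ∧ meromorphicOrderAt FM m < 0 := by
  have hex : ∀ j : ℕ, _ := fun j => exists_pole_M (2 * j + 5) (by omega) ⟨j + 2, by ring⟩
  choose μ hμ hz hz1 hoth using hex
  have hinj : Function.Injective μ := by
    intro i j hij
    by_contra hne
    have h1 := hoth j (2 * i + 5) (by omega) (by omega)
    rw [← hij] at h1
    exact h1 (hz i)
  have hS : ({t : ℂ | P.eval t = 0} ∪ {1 / 4}).Finite := by
    refine Set.Finite.union ?_ (Set.finite_singleton _)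
    refine P.roots.toFinset.finite_toSet.subset fun t ht => ?_
    simp only [Finset.mem_coe, Multiset.mem_toFinset]
    exact (Polynomial.mem_roots hP).2 ht
  have hbad := (tM_fiber_finite hS).union (Set.finite_singleton 0)
  obtain ⟨m, ⟨j, rfl⟩, hm⟩ := (Set.infinite_range_of_injective hinj).exists_notMem_finite hbad
  have h0 : μ j ≠ 0 := fun h => hm (Or.inr h)
  have h1 : P.eval (tM (μ j)) ≠ 0 := fun h => hm (Or.inl ⟨hμ j, Or.inl h⟩)
  have h2 : 1 - 4 * tM (μ j) ≠ 0 := fun h =>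
    hm (Or.inl ⟨hμ j, Or.inr (by show tM (μ j) = 1 / 4; linear_combination -h / 4)⟩)
  exact ⟨μ j, hμ j, h0, h1, FM_pole (hμ j) h2 (hz j) (hz1 j) (hoth j)⟩

lemma TamePS_iter {φ : PowerSeries ℚ} (h : TamePS φ) (i : ℕ) :
    TamePS (PowerSeries.derivativeFun^[i] φ) := by
  induction i with
  | zero => exact h
  | succ i ih => rw [Function.iterate_succ_apply']; exact ih.deriv

theorem modelB_not_DFinite :
    ¬ ∃ (r : ℕ) (p : ℕ → Polynomial ℚ),
      (∃ i, i ≤ r ∧ p i ≠ 0) ∧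
      ∑ i ∈ Finset.range (r + 1),
        (p i : PowerSeries ℚ) *
          (PowerSeries.derivativeFun^[i] (walkGF ({(-1,1),(0,1),(1,0),(1,-1)} : Finset (ℤ × ℤ)))) = 0 := by
  rintro ⟨r, p, ⟨i0, hi0, hpi0⟩, hode⟩
  change ∑ i ∈ Finset.range (r + 1),
        (p i : PowerSeries ℚ) * (PowerSeries.derivativeFun^[i] (walkGF stepB)) = 0 at hode
  classical
  set r' := Nat.findGreatest (fun i => p i ≠ 0) r with hr'
  have hpr : p r' ≠ 0 := Nat.findGreatest_spec (P := fun i => p i ≠ 0) hi0 hpi0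
  have hr'r : r' ≤ r := Nat.findGreatest_le r
  have hode' : ∑ i ∈ Finset.range (r' + 1),
        (p i : PowerSeries ℚ) * (PowerSeries.derivativeFun^[i] (walkGF stepB)) = 0 := by
    rw [← hode]
    refine Finset.sum_subset (Finset.range_subset_range.2 (by omega)) fun i hi hi' => ?_
    have h1 : p i = 0 := by
      by_contra h
      rw [Finset.mem_range] at hi hi'
      exact Nat.findGreatest_is_greatest (P := fun i => p i ≠ 0) (n := r) (k := i)
        (by omega) (by omega) h
    rw [h1]; simp
  have hP : (p r').map (algebraMap ℚ ℂ) ≠ 0 := by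
    rwa [Ne, Polynomial.map_eq_zero]
  obtain ⟨m0, hm0, hm00, hPe, hpole⟩ := exists_good_pole hP
  refine no_pole_of_ode (τ := tM) (F := FM) (Ω := OmM) OmM_preconnected
    (fun m hm => tM_analytic hm) (fun m hm => FM_meromorphic hm) half_mem
    (tM_deriv half_mem (by norm_num)) (W := Metric.ball 0 (1 / 4)) Metric.isOpen_ball
    (by rw [mem_ball_zero_iff]; exact tM_small half_mem aM_half)
    (f := fun i => evPS (PowerSeries.derivativeFun^[i] (walkGF stepB))) ?_ FM_base
    (r := r') (P := fun i => (p i).map (algebraMap ℚ ℂ)) ?_ hm0 (tM_deriv hm0 hm00) hPe hpole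
  · intro i t ht
    rw [mem_ball_zero_iff] at ht
    have := evPS_hasDerivAt (TamePS_iter walkGF_tame i) ht
    rwa [← Function.iterate_succ_apply' PowerSeries.derivativeFun] at this
  · intro t ht
    rw [mem_ball_zero_iff] at ht
    exact evPS_ode walkGF_tame hode' ht
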